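/- arXiv:2502.15659 — 2 statements merged into one kernel-verified Lean document; each statement's English description precedes it below -/
import Mathlib

section
/- Let k ≥ 2, let ρ be a density matrix on ℂ^{dA} ⊗ ℂ^{dB}. Then for every n ≥ 1: D(ρ^{⊗n} ‖ PPT_k(Aⁿ:Bⁿ)) ≥ n · D_M(ρ ‖ PPT_k(A:B)), where ρ^{⊗n} is the n-fold Kronecker power reindexed so that the bipartition is (Aⁿ) versus (Bⁿ), and PPT_k(Aⁿ:Bⁿ) is the PPT_k set on (ℂ^{dA})^{⊗n} ⊗ (ℂ^{dB})^{⊗n} with partial transpose over all B factors. -/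
open scoped Kronecker ComplexOrder Matrix

attribute [local instance] Classical.propDecidable

noncomputable section

namespace QIT

variable {n : Type*} [Fintype n] [DecidableEq n]

/-- Base-2 matrix logarithm taken on the support (junk value `0` for non-Hermitian input). -/
def matLog (A : Matrix n n ℂ) : Matrix n n ℂ :=
  if hA : A.IsHermitian then
    (hA.eigenvectorUnitary : Matrix n n ℂ) *
      Matrix.diagonal (fun i => if hA.eigenvalues i = 0 then (0 : ℂ)
        else (Real.logb 2 (hA.eigenvalues i) : ℂ)) *
      (hA.eigenvectorUnitary : Matrix n n ℂ)ᴴ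
  else 0

/-- Orthogonal projection onto the support of a Hermitian matrix. -/
def suppProj (A : Matrix n n ℂ) : Matrix n n ℂ :=
  if hA : A.IsHermitian then
    (hA.eigenvectorUnitary : Matrix n n ℂ) *
      Matrix.diagonal (fun i => if hA.eigenvalues i = 0 then (0 : ℂ) else 1) *
      (hA.eigenvectorUnitary : Matrix n n ℂ)ᴴ
  else 0

/-- Support inclusion `supp ρ ⊆ supp σ`, phrased via kernels. -/
def suppLE (ρ σ : Matrix n n ℂ) : Prop :=
  ∀ x : n → ℂ, σ.mulVec x = 0 → ρ.mulVec x = 0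

/-- Umegaki relative entropy (base 2), `+∞` when supports are not included. -/
def relEnt (ρ σ : Matrix n n ℂ) : EReal :=
  if suppLE ρ σ then (((ρ * (matLog ρ - matLog σ)).trace).re : EReal) else ⊤

/-- Classical relative-entropy summand `p log₂(p/q)` with conventions
`0 · log(0/q) = 0` and `p · log(p/0) = +∞` for `p ≠ 0`. -/
def klTerm (p q : ℝ) : EReal :=
  if p = 0 then 0 else if q = 0 then ⊤ else ((p * Real.logb 2 (p / q) : ℝ) : EReal)

/-- A finite POVM. -/
def IsPOVM {m : ℕ} (M : Fin m → Matrix n n ℂ) : Prop :=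
  (∀ x, (M x).PosSemidef) ∧ ∑ x, M x = 1

/-- Measured relative entropy (base 2). -/
def measRelEnt (ρ σ : Matrix n n ℂ) : EReal :=
  ⨆ (m : ℕ) (M : Fin m → Matrix n n ℂ) (_ : IsPOVM M),
    ∑ x, klTerm ((M x * ρ).trace).re ((M x * σ).trace).re

/-- Trace norm: sum of singular values. -/
def traceNorm (A : Matrix n n ℂ) : ℝ :=
  ∑ i, Real.sqrt ((Matrix.posSemidef_conjTranspose_mul_self A).1.eigenvalues i)

/-- Operator (spectral) norm: largest singular value. -/
def opNorm (A : Matrix n n ℂ) : ℝ :=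
  ⨆ i, Real.sqrt ((Matrix.posSemidef_conjTranspose_mul_self A).1.eigenvalues i)

/-- Partial transpose on the second tensor factor. -/
def ptB {α β : Type*} (X : Matrix (α × β) (α × β) ℂ) : Matrix (α × β) (α × β) ℂ :=
  Matrix.of fun p q => X (p.1, q.2) (q.1, p.2)

/-- Kronecker product of two bipartite matrices, reindexed to the bipartition (A×A') : (B×B'). -/
def kron2 {α β γ δ : Type*} (X : Matrix (α × β) (α × β) ℂ) (Y : Matrix (γ × δ) (γ × δ) ℂ) :
    Matrix ((α × γ) × β × δ) ((α × γ) × β × δ) ℂ :=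
  Matrix.reindex (Equiv.prodProdProdComm α β γ δ) (Equiv.prodProdProdComm α β γ δ) (X ⊗ₖ Y)

/-- The permutation unitary on `(ℂ^d)^{⊗ m}`. -/
def permMat (d m : ℕ) (π : Equiv.Perm (Fin m)) :
    Matrix (Fin m → Fin d) (Fin m → Fin d) ℂ :=
  Matrix.of fun f g => if f ∘ π = g then 1 else 0

/-- Membership in the `PPT_k` set. -/
def memPPTk {α β : Type*} [Fintype α] [Fintype β] [DecidableEq α] [DecidableEq β]
    (k : ℕ) (X : Matrix (α × β) (α × β) ℂ) : Prop :=
  X.PosSemidef ∧ ∃ ω : ℕ → Matrix (α × β) (α × β) ℂ,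
    ω 1 = X ∧ (∀ i ∈ Finset.Icc 1 k, (ω i).IsHermitian) ∧
    (∀ i ∈ Finset.Icc 1 (k - 1),
      ((ω (i + 1)) - ptB (ω i)).PosSemidef ∧ ((ω (i + 1)) + ptB (ω i)).PosSemidef) ∧
    traceNorm (ptB (ω k)) ≤ 1

/-- Membership in the Rains set. -/
def memRains {α β : Type*} [Fintype α] [Fintype β] [DecidableEq α] [DecidableEq β]
    (σ : Matrix (α × β) (α × β) ℂ) : Prop :=
  σ.PosSemidef ∧ traceNorm (ptB σ) ≤ 1


/-- The `n`-fold tensor power of a bipartite matrix, with the bipartition `(Aⁿ : Bⁿ)`. -/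
def kronPowBip {dA dB : ℕ} (n : ℕ) (ρ : Matrix (Fin dA × Fin dB) (Fin dA × Fin dB) ℂ) :
    Matrix ((Fin n → Fin dA) × (Fin n → Fin dB)) ((Fin n → Fin dA) × (Fin n → Fin dB)) ℂ :=
  Matrix.of fun p q => ∏ i : Fin n, ρ (p.1 i, p.2 i) (q.1 i, q.2 i)

/-! ### Traces and positivity -/

theorem exists_eq_conjTranspose_mul_self {A : Matrix n n ℂ} (hA : A.PosSemidef) :
    ∃ C : Matrix n n ℂ, A = Cᴴ * C := by
  open scoped MatrixOrder in
  obtain ⟨C, hC⟩ := CStarAlgebra.nonneg_iff_eq_star_mul_self.mp (Matrix.nonneg_iff_posSemidef.mpr hA)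
  exact ⟨C, hC⟩

theorem re_trace_mul_nonneg {A B : Matrix n n ℂ} (hA : A.PosSemidef) (hB : B.PosSemidef) :
    0 ≤ ((A * B).trace).re := by
  obtain ⟨C, rfl⟩ := exists_eq_conjTranspose_mul_self hB
  rw [← Matrix.mul_assoc, Matrix.trace_mul_comm, ← Matrix.mul_assoc]
  exact (Complex.nonneg_iff.mp (hA.mul_mul_conjTranspose_same C).trace_nonneg).1

theorem re_trace_mul_le {A B X : Matrix n n ℂ} (hX : X.PosSemidef) (h : (B - A).PosSemidef) :
    ((X * A).trace).re ≤ ((X * B).trace).re := by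
  have := re_trace_mul_nonneg hX h
  rw [Matrix.mul_sub, Matrix.trace_sub, Complex.sub_re] at this
  linarith

/-- If `-ω' ≤ ω ≤ ω'` and `-T ≤ E ≤ T`, then `tr ωE ≤ tr ω'T`. -/
theorem re_trace_mul_le_of_abs_le {ω ω' E T : Matrix n n ℂ}
    (h₁ : (ω' - ω).PosSemidef) (h₂ : (ω' + ω).PosSemidef)
    (h₃ : (T - E).PosSemidef) (h₄ : (T + E).PosSemidef) :
    ((ω * E).trace).re ≤ ((ω' * T).trace).re := by
  have a := re_trace_mul_nonneg h₁ h₄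
  have b := re_trace_mul_nonneg h₂ h₃
  simp only [Matrix.mul_add, Matrix.mul_sub, Matrix.add_mul, Matrix.sub_mul, Matrix.trace_add,
    Matrix.trace_sub, Complex.add_re, Complex.sub_re] at a b
  linarith

/-- A Hermitian contraction (up to the scale `s`) has square at most `s²`. -/
theorem posSemidef_sq_sub_sq {E : Matrix n n ℂ} {s : ℝ} (hs : 0 < s)
    (h₁ : ((s : ℂ) • (1 : Matrix n n ℂ) - E).PosSemidef)
    (h₂ : ((s : ℂ) • (1 : Matrix n n ℂ) + E).PosSemidef) :
    (((s : ℂ) ^ 2) • (1 : Matrix n n ℂ) - E * E).PosSemidef := by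
  have a := h₂.mul_mul_conjTranspose_same ((s : ℂ) • (1 : Matrix n n ℂ) - E)
  have b := h₁.mul_mul_conjTranspose_same ((s : ℂ) • (1 : Matrix n n ℂ) + E)
  rw [h₁.1.eq] at a
  rw [h₂.1.eq] at b
  have c := (a.add b).smul (a := ((2 * s)⁻¹ : ℝ)) (by positivity)
  have hs' : (s : ℂ) ≠ 0 := by exact_mod_cast hs.ne'
  convert c using 1
  have : ((s : ℂ) • (1 : Matrix n n ℂ) - E) * ((s : ℂ) • 1 + E) * ((s : ℂ) • 1 - E) +
      ((s : ℂ) • (1 : Matrix n n ℂ) + E) * ((s : ℂ) • 1 - E) * ((s : ℂ) • 1 + E) =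
      (2 * s : ℂ) • (((s : ℂ) ^ 2) • (1 : Matrix n n ℂ) - E * E) := by
    simp only [Matrix.mul_add, Matrix.mul_sub, Matrix.add_mul, Matrix.sub_mul, Matrix.smul_mul,
      Matrix.mul_smul, Matrix.one_mul, Matrix.mul_one, smul_add, smul_sub, smul_smul]
    module
  rw [this, ← Complex.coe_smul, smul_smul]
  push_cast
  rw [inv_mul_cancel₀ (by simpa using hs'), one_smul]

theorem posSemidef_of_re_trace_mul_nonneg {ι : Type*} [Fintype ι]
    {ω : Matrix ι ι ℂ} (hω : ω.IsHermitian)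
    (h : ∀ X : Matrix ι ι ℂ, X.PosSemidef → 0 ≤ ((ω * X).trace).re) : ω.PosSemidef := by
  refine .of_dotProduct_mulVec_nonneg hω fun x => ?_
  have := h _ (Matrix.posSemidef_vecMulVec_self_star x)
  rw [Matrix.mul_vecMulVec, Matrix.trace_vecMulVec, dotProduct_comm] at this
  rw [Complex.nonneg_iff]
  refine ⟨this, ?_⟩
  have := Matrix.IsHermitian.im_star_dotProduct_mulVec_self hω x
  exact this.symm

/-! ### Spectral decompositions -/

theorem spectral_decomp {A : Matrix n n ℂ} (hA : A.IsHermitian) :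
    A = (hA.eigenvectorUnitary : Matrix n n ℂ) *
      Matrix.diagonal (fun i => (hA.eigenvalues i : ℂ)) *
      (hA.eigenvectorUnitary : Matrix n n ℂ)ᴴ := by
  conv_lhs => rw [hA.spectral_theorem]
  rfl

theorem eigenvectorUnitary_conjTranspose_mul {A : Matrix n n ℂ} (hA : A.IsHermitian) :
    (hA.eigenvectorUnitary : Matrix n n ℂ)ᴴ * (hA.eigenvectorUnitary : Matrix n n ℂ) = 1 :=
  Unitary.coe_star_mul_self _

theorem eigenvectorUnitary_mul_conjTranspose {A : Matrix n n ℂ} (hA : A.IsHermitian) :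
    (hA.eigenvectorUnitary : Matrix n n ℂ) * (hA.eigenvectorUnitary : Matrix n n ℂ)ᴴ = 1 :=
  Unitary.coe_mul_star_self _

theorem conj_eigenvectorUnitary {A : Matrix n n ℂ} (hA : A.IsHermitian) :
    (hA.eigenvectorUnitary : Matrix n n ℂ)ᴴ * A * (hA.eigenvectorUnitary : Matrix n n ℂ) =
      Matrix.diagonal (fun i => (hA.eigenvalues i : ℂ)) := by
  set U := (hA.eigenvectorUnitary : Matrix n n ℂ) with hU
  have h := spectral_decomp hA
  have h1 : Uᴴ * U = 1 := eigenvectorUnitary_conjTranspose_mul hA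
  calc Uᴴ * A * U = Uᴴ * (U * Matrix.diagonal (fun i => (hA.eigenvalues i : ℂ)) * Uᴴ) * U := by
        rw [← h]
    _ = (Uᴴ * U) * Matrix.diagonal (fun i => (hA.eigenvalues i : ℂ)) * (Uᴴ * U) := by
        simp only [Matrix.mul_assoc]
    _ = _ := by rw [h1, Matrix.one_mul, Matrix.mul_one]

/-! ### The trace norm -/

theorem re_trace_conjTranspose_mul_le {ι : Type*} [Fintype ι]
    (X Y : Matrix ι ι ℂ) :
    ((Xᴴ * Y).trace).re ≤
      ∑ j, √(((Xᴴ * X) j j).re) * √(((Yᴴ * Y) j j).re) := by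
  have key : ∀ (Z : Matrix ι ι ℂ) j, ((Zᴴ * Z) j j).re = ∑ i, ‖Z i j‖ ^ 2 := by
    intro Z j
    simp only [Matrix.mul_apply, Matrix.conjTranspose_apply, Complex.re_sum]
    refine Finset.sum_congr rfl fun i _ => ?_
    rw [Complex.star_def, ← Complex.normSq_eq_conj_mul_self, Complex.ofReal_re,
      Complex.normSq_eq_norm_sq]
  rw [Matrix.trace, Complex.re_sum]
  refine Finset.sum_le_sum fun j _ => ?_
  rw [key, key]
  calc (((Xᴴ * Y).diag j).re) ≤ ‖(Xᴴ * Y) j j‖ := Complex.re_le_norm _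
    _ ≤ ∑ i, ‖X i j‖ * ‖Y i j‖ := by
        rw [Matrix.mul_apply]
        refine (norm_sum_le _ _).trans (le_of_eq ?_)
        simp
    _ ≤ _ := Real.sum_mul_le_sqrt_mul_sqrt _ _ _

theorem re_trace_mul_le_traceNorm {A E : Matrix n n ℂ} {s : ℝ} (hA : A.IsHermitian) (hs : 0 < s)
    (h₁ : ((s : ℂ) • (1 : Matrix n n ℂ) - E).PosSemidef)
    (h₂ : ((s : ℂ) • (1 : Matrix n n ℂ) + E).PosSemidef) :
    ((A * E).trace).re ≤ s * traceNorm A := by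
  have hE : E.IsHermitian := by
    have := h₂.1.sub h₁.1
    have h : E = (2⁻¹ : ℝ) • ((s : ℂ) • (1 : Matrix n n ℂ) + E - ((s : ℂ) • 1 - E)) := by
      module
    rw [h]
    exact this.smul (by simp [IsSelfAdjoint])
  set hAA := (Matrix.posSemidef_conjTranspose_mul_self A).1 with hAA_def
  set U := (hAA.eigenvectorUnitary : Matrix n n ℂ) with hU
  have hU1 : Uᴴ * U = 1 := eigenvectorUnitary_conjTranspose_mul hAA
  have hU2 : U * Uᴴ = 1 := eigenvectorUnitary_mul_conjTranspose hAA
  have htr : (A * E).trace = ((A * U)ᴴ * (E * U)).trace := by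
    rw [Matrix.conjTranspose_mul, hA.eq, Matrix.mul_assoc, Matrix.trace_mul_comm Uᴴ]
    simp only [Matrix.mul_assoc, hU2, Matrix.mul_one]
  have h1 : ∀ j, (((A * U)ᴴ * (A * U)) j j).re = hAA.eigenvalues j := by
    intro j
    have : (A * U)ᴴ * (A * U) = Uᴴ * (Aᴴ * A) * U := by
      rw [Matrix.conjTranspose_mul]; simp only [Matrix.mul_assoc]
    rw [this, conj_eigenvectorUnitary hAA]
    simp
  have h2 : ∀ j, √((((E * U)ᴴ * (E * U)) j j).re) ≤ s := by
    intro j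
    have hp := ((posSemidef_sq_sub_sq hs h₁ h₂).conjTranspose_mul_mul_same U).diag_nonneg (i := j)
    have : Uᴴ * ((s : ℂ) ^ 2 • (1 : Matrix n n ℂ) - E * E) * U =
        (s : ℂ) ^ 2 • (1 : Matrix n n ℂ) - (E * U)ᴴ * (E * U) := by
      rw [Matrix.conjTranspose_mul, hE.eq, Matrix.mul_sub, Matrix.sub_mul, Matrix.mul_smul,
        Matrix.mul_one, Matrix.smul_mul, hU1]
      simp only [Matrix.mul_assoc]
    rw [this] at hp
    have hp' := (Complex.nonneg_iff.mp hp).1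
    rw [Matrix.sub_apply, Matrix.smul_apply, Matrix.one_apply_eq, Complex.sub_re, smul_eq_mul,
      mul_one, ← Complex.ofReal_pow, Complex.ofReal_re] at hp'
    exact Real.sqrt_le_iff.mpr ⟨hs.le, by linarith⟩
  rw [htr]
  refine (re_trace_conjTranspose_mul_le _ _).trans ?_
  rw [traceNorm, Finset.mul_sum]
  refine Finset.sum_le_sum fun j _ => ?_
  rw [h1, mul_comm]
  exact mul_le_mul_of_nonneg_right (h2 j) (Real.sqrt_nonneg _)

/-- The trace norm of a Hermitian matrix is attained on a Hermitian contraction. -/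
theorem exists_contraction_trace_eq_traceNorm {A : Matrix n n ℂ} (hA : A.IsHermitian) :
    ∃ Z : Matrix n n ℂ, (1 - Z).PosSemidef ∧ (1 + Z).PosSemidef ∧
      ((A * Z).trace).re = traceNorm A := by
  set hAA := (Matrix.posSemidef_conjTranspose_mul_self A).1 with hAA_def
  set U := (hAA.eigenvectorUnitary : Matrix n n ℂ) with hU
  set l := hAA.eigenvalues with hl
  have hl0 : ∀ j, 0 ≤ l j := fun j => Matrix.eigenvalues_conjTranspose_mul_self_nonneg A j
  have hU1 : Uᴴ * U = 1 := eigenvectorUnitary_conjTranspose_mul hAA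
  have hU2 : U * Uᴴ = 1 := eigenvectorUnitary_mul_conjTranspose hAA
  have hd := conj_eigenvectorUnitary hAA
  rw [← hU, ← hl] at hd
  set V : Matrix n n ℂ := Matrix.diagonal (fun j => (((√(l j))⁻¹ : ℝ) : ℂ)) with hV
  have hVh : Vᴴ = V := by
    rw [hV, Matrix.diagonal_conjTranspose]
    congr 1; ext j; simp
  set N := U * V * Uᴴ with hN
  have hNh : Nᴴ = N := by
    rw [hN]; simp only [Matrix.conjTranspose_mul, Matrix.conjTranspose_conjTranspose, hVh,
      Matrix.mul_assoc]
  set Y := N * Aᴴ with hY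
  have hYY : Y * Yᴴ = U * (V * Matrix.diagonal (fun i => (l i : ℂ)) * V) * Uᴴ := by
    rw [← hd, hY, Matrix.conjTranspose_mul, hNh, hN]
    simp only [Matrix.mul_assoc, Matrix.conjTranspose_conjTranspose]
  have hYY1 : (1 - Y * Yᴴ).PosSemidef := by
    have h : 1 - Y * Yᴴ =
        U * (1 - V * Matrix.diagonal (fun i => (l i : ℂ)) * V) * Uᴴ := by
      rw [hYY, Matrix.mul_sub, Matrix.sub_mul, Matrix.mul_one, hU2]
    rw [h]
    refine Matrix.PosSemidef.mul_mul_conjTranspose_same ?_ U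
    rw [hV, Matrix.diagonal_mul_diagonal, Matrix.diagonal_mul_diagonal, ← Matrix.diagonal_one,
      Matrix.diagonal_sub]
    refine Matrix.PosSemidef.diagonal fun j => ?_
    have : (√(l j))⁻¹ * l j * (√(l j))⁻¹ ≤ 1 := by
      rcases (hl0 j).eq_or_lt with h0 | h0
      · simp [← h0]
      · have h3 : √(l j) * √(l j) = l j := Real.mul_self_sqrt h0.le
        have h4 : 0 < √(l j) := Real.sqrt_pos.mpr h0
        apply le_of_eq
        field_simp
        nlinarith
    simp only [Pi.zero_apply]
    rw [← Complex.ofReal_mul, ← Complex.ofReal_mul, ← Complex.ofReal_one, ← Complex.ofReal_sub]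
    exact_mod_cast sub_nonneg.mpr this
  have hA' : ((A * Y).trace).re = traceNorm A := by
    have : (A * Y).trace = (V * Matrix.diagonal (fun i => (l i : ℂ))).trace := by
      have h1 : A * Y = A * U * (V * (Uᴴ * Aᴴ)) := by
        rw [hY, hN]; simp only [Matrix.mul_assoc]
      rw [h1, Matrix.trace_mul_comm, ← hd]
      simp only [Matrix.mul_assoc]
    rw [this, hV, Matrix.diagonal_mul_diagonal, Matrix.trace_diagonal, Complex.re_sum, traceNorm]
    refine Finset.sum_congr rfl fun j _ => ?_
    rw [← Complex.ofReal_mul, Complex.ofReal_re]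
    change (√(l j))⁻¹ * l j = √(l j)
    rcases (hl0 j).eq_or_lt with h0 | h0
    · simp [← h0]
    · have h3 : √(l j) * √(l j) = l j := Real.mul_self_sqrt h0.le
      have h4 : 0 < √(l j) := Real.sqrt_pos.mpr h0
      field_simp
      nlinarith
  have half : ∀ X : Matrix n n ℂ, X.PosSemidef → ((2⁻¹ : ℝ) • X).PosSemidef :=
    fun X hX => hX.smul (by positivity)
  refine ⟨(2⁻¹ : ℝ) • (Y + Yᴴ), ?_, ?_, ?_⟩
  · have := half _ ((Matrix.posSemidef_self_mul_conjTranspose (1 - Y)).add hYY1)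
    convert this using 1
    rw [Matrix.conjTranspose_sub, Matrix.conjTranspose_one, Matrix.sub_mul, Matrix.mul_sub,
      Matrix.mul_sub, Matrix.one_mul, Matrix.mul_one, Matrix.one_mul]
    module
  · have := half _ ((Matrix.posSemidef_self_mul_conjTranspose (1 + Y)).add hYY1)
    convert this using 1
    rw [Matrix.conjTranspose_add, Matrix.conjTranspose_one, Matrix.add_mul, Matrix.mul_add,
      Matrix.mul_add, Matrix.one_mul, Matrix.mul_one, Matrix.one_mul]
    module
  · have hc : (A * Yᴴ).trace = star ((A * Y).trace) := by
      rw [← Matrix.trace_conjTranspose, Matrix.conjTranspose_mul A Y, hA.eq, Matrix.trace_mul_comm]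
    rw [Matrix.mul_smul, Matrix.mul_add, Matrix.trace_smul, Matrix.trace_add, hc,
      Complex.real_smul, Complex.re_ofReal_mul, Complex.add_re, Complex.star_def, Complex.conj_re,
      hA']
    ring

/-! ### Monotonicity of the relative entropy under measurements -/

theorem hasDerivAt_mul_log_add {k r s t : ℝ} (hr : 0 ≤ r)
    (h : k * r ≠ 0 → 0 < s) (ht : 0 ≤ t) :
    HasDerivAt (fun t => k * r * Real.log (s + t * r)) (k * r ^ 2 / (s + t * r)) t := by
  by_cases hk : k * r = 0
  · have h2 : k * r ^ 2 / (s + t * r) = 0 := by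
      rw [pow_two, ← mul_assoc, hk, zero_mul, zero_div]
    simp only [hk, zero_mul, h2]
    exact hasDerivAt_const _ _
  · have hs' := h hk
    have h3 : s + t * r ≠ 0 := by positivity
    have h4 : HasDerivAt (fun t => s + t * r) r t := by
      simpa using ((hasDerivAt_id t).mul_const r).const_add s
    exact ((h4.log h3).const_mul (k * r)).congr_deriv (by ring)

theorem hasDerivAt_classical_part {p q v t : ℝ} (hv : 0 < v) (ht : 0 ≤ t) :
    HasDerivAt (fun t => p * (Real.log (1 + t * v) - (1 + t * v)⁻¹) + q * v * (1 + t * v)⁻¹)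
      (2 * (v / (1 + t * v)) * p - (v / (1 + t * v)) ^ 2 * q - t * ((v / (1 + t * v)) ^ 2 * p)) t := by
  have h3 : 1 + t * v ≠ 0 := by positivity
  have h4 : HasDerivAt (fun t => 1 + t * v) v t := by
    simpa using ((hasDerivAt_id t).mul_const v).const_add 1
  refine ((((h4.log h3).sub (h4.inv h3)).const_mul p).add
    ((h4.inv h3).const_mul (q * v))).congr_deriv ?_
  field_simp
  ring

/-- Comparison of a weighted entropy difference with a classical variational expression, obtained
by integrating a family of quadratic inequalities over the parameter `t`. -/
theorem classical_le_of_quadratic_le {ι X : Type*} [Fintype ι] [Fintype X]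
    (k r s : ι → ℝ) (hk : ∀ j, 0 ≤ k j) (hr : ∀ j, 0 ≤ r j) (hs : ∀ j, 0 ≤ s j)
    (hrs : ∀ j, k j * r j ≠ 0 → 0 < s j)
    (p q v : X → ℝ) (hp : ∀ x, 0 ≤ p x) (hq : ∀ x, 0 ≤ q x) (hv : ∀ x, 0 < v x)
    (hsum : ∑ j, k j * r j = ∑ x, p x)
    (hquad : ∀ t, 0 ≤ t → ∀ c : X → ℝ,
      2 * ∑ x, c x * p x - ∑ x, c x ^ 2 * q x - t * ∑ x, c x ^ 2 * p x ≤
        ∑ j, k j * r j ^ 2 / (s j + t * r j)) :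
    ∑ x, p x * Real.log (v x) + ∑ x, p x - ∑ x, q x * v x ≤
      ∑ j, k j * r j * (Real.log (r j) - Real.log (s j)) := by
  set H : ℝ → ℝ := fun t => ∑ j, k j * r j * Real.log (s j + t * r j) -
    ∑ x, (p x * (Real.log (1 + t * v x) - (1 + t * v x)⁻¹) + q x * v x * (1 + t * v x)⁻¹) with hH
  have hder : ∀ t, 0 ≤ t → HasDerivAt H (∑ j, k j * r j ^ 2 / (s j + t * r j) -
      ∑ x, (2 * (v x / (1 + t * v x)) * p x - (v x / (1 + t * v x)) ^ 2 * q x -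
        t * ((v x / (1 + t * v x)) ^ 2 * p x))) t := by
    intro t ht
    exact (HasDerivAt.fun_sum fun j _ => hasDerivAt_mul_log_add (hr j) (hrs j) ht).sub
      (HasDerivAt.fun_sum fun x _ => hasDerivAt_classical_part (hv x) ht)
  have hmono : MonotoneOn H (Set.Ici 0) := by
    refine monotoneOn_of_deriv_nonneg (convex_Ici 0)
      (fun t ht => (hder t ht).continuousAt.continuousWithinAt)
      (fun t ht => (hder t (interior_subset ht)).differentiableAt.differentiableWithinAt) ?_
    intro t ht
    have ht0 : 0 ≤ t := interior_subset (s := Set.Ici (0 : ℝ)) ht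
    rw [(hder t ht0).deriv]
    have := hquad t ht0 (fun x => v x / (1 + t * v x))
    rw [Finset.mul_sum, Finset.mul_sum, ← Finset.sum_sub_distrib, ← Finset.sum_sub_distrib] at this
    simp only [← mul_assoc] at this ⊢
    linarith
  have hupper : ∀ t, 0 < t → H t ≤ (∑ j, k j * r j * Real.log (r j) -
      ∑ x, p x * Real.log (v x)) + (∑ j, k j * s j + ∑ x, p x * (v x)⁻¹) * t⁻¹ := by
    intro t ht
    have h1 : ∀ j, k j * r j * Real.log (s j + t * r j) ≤
        k j * r j * Real.log t + k j * r j * Real.log (r j) + k j * s j * t⁻¹ := by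
      intro j
      rcases (hr j).eq_or_lt with h0 | h0
      · rw [← h0]
        have := mul_nonneg (mul_nonneg (hk j) (hs j)) (inv_nonneg.mpr ht.le)
        simpa using this
      · have hpos : 0 < t * r j := by positivity
        have h2 : s j + t * r j = (t * r j) * (1 + s j / (t * r j)) := by field_simp; ring
        have h3 : 0 < 1 + s j / (t * r j) := by
          have := div_nonneg (hs j) hpos.le
          linarith
        have h4 := Real.log_le_sub_one_of_pos h3
        rw [h2, Real.log_mul hpos.ne' h3.ne', Real.log_mul ht.ne' h0.ne']
        have h5 : k j * r j * Real.log (1 + s j / (t * r j)) ≤ k j * r j * (s j / (t * r j)) :=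
          mul_le_mul_of_nonneg_left (by linarith) (mul_nonneg (hk j) (hr j))
        have h6 : k j * r j * (s j / (t * r j)) = k j * s j * t⁻¹ := by field_simp
        rw [h6] at h5
        linarith
    have h2 : ∀ x, p x * Real.log t + p x * Real.log (v x) - p x * (v x)⁻¹ * t⁻¹ ≤
        p x * (Real.log (1 + t * v x) - (1 + t * v x)⁻¹) + q x * v x * (1 + t * v x)⁻¹ := by
      intro x
      have hvx := hv x
      have hpos : 0 < t * v x := by positivity
      have a : Real.log t + Real.log (v x) ≤ Real.log (1 + t * v x) := by
        rw [← Real.log_mul ht.ne' hvx.ne']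
        exact Real.log_le_log hpos (by linarith)
      have b : (1 + t * v x)⁻¹ ≤ (v x)⁻¹ * t⁻¹ := by
        rw [← mul_inv, mul_comm (v x)]
        exact inv_anti₀ hpos (by linarith)
      have c : 0 ≤ q x * v x * (1 + t * v x)⁻¹ := by
        have := hq x
        positivity
      have d := mul_le_mul_of_nonneg_left (sub_le_sub a b) (hp x)
      nlinarith
    have h3 := Finset.sum_le_sum fun j (_ : j ∈ Finset.univ) => h1 j
    have h4 := Finset.sum_le_sum fun x (_ : x ∈ Finset.univ) => h2 x
    simp only [Finset.sum_add_distrib, Finset.sum_sub_distrib, ← Finset.sum_mul] at h3 h4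
    rw [hsum] at h3
    rw [hH]
    simp only [Finset.sum_add_distrib]
    linarith
  have hlim : H 0 ≤ ∑ j, k j * r j * Real.log (r j) - ∑ x, p x * Real.log (v x) := by
    have htend : Filter.Tendsto (fun t : ℝ => (∑ j, k j * r j * Real.log (r j) -
        ∑ x, p x * Real.log (v x)) + (∑ j, k j * s j + ∑ x, p x * (v x)⁻¹) * t⁻¹) Filter.atTop
        (nhds ((∑ j, k j * r j * Real.log (r j) - ∑ x, p x * Real.log (v x)) +
          (∑ j, k j * s j + ∑ x, p x * (v x)⁻¹) * 0)) :=
      (tendsto_inv_atTop_zero.const_mul _).const_add _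
    rw [mul_zero, add_zero] at htend
    refine ge_of_tendsto htend ?_
    filter_upwards [Filter.eventually_gt_atTop 0] with t ht
    exact (hmono (Set.mem_Ici.mpr le_rfl) (Set.mem_Ici.mpr ht.le) ht.le).trans (hupper t ht)
  have h0 : H 0 = ∑ j, k j * r j * Real.log (s j) - ∑ x, (- p x + q x * v x) := by
    simp [hH]
  rw [h0] at hlim
  simp only [Finset.sum_add_distrib, Finset.sum_neg_distrib] at hlim
  simp only [mul_sub, Finset.sum_sub_distrib]
  linarith

theorem trace_diagonal_mul (d : n → ℂ) (Y : Matrix n n ℂ) :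
    (Matrix.diagonal d * Y).trace = ∑ a, d a * Y a a := by
  simp [Matrix.trace, Matrix.diagonal_mul]

theorem trace_unitary_conj_mul (U Y : Matrix n n ℂ) (d : n → ℂ) :
    (U * Matrix.diagonal d * Uᴴ * Y).trace = ∑ a, d a * (Uᴴ * Y * U) a a := by
  rw [← trace_diagonal_mul, Matrix.mul_assoc, Matrix.mul_assoc, Matrix.trace_mul_comm]
  simp only [Matrix.mul_assoc]

theorem mul_conjTranspose_diag_re {ι : Type*} [Fintype ι] (X : Matrix ι ι ℂ) (a : ι) :
    (X * Xᴴ) a a = ((∑ b, ‖X a b‖ ^ 2 : ℝ) : ℂ) := by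
  simp only [Matrix.mul_apply, Matrix.conjTranspose_apply, Complex.ofReal_sum]
  exact Finset.sum_congr rfl fun b _ => by
    rw [Complex.star_def, Complex.mul_conj, Complex.normSq_eq_norm_sq]

theorem conjTranspose_mul_diag_re {ι : Type*} [Fintype ι] (X : Matrix ι ι ℂ) (a : ι) :
    (Xᴴ * X) a a = ((∑ b, ‖X b a‖ ^ 2 : ℝ) : ℂ) := by
  simp only [Matrix.mul_apply, Matrix.conjTranspose_apply, Complex.ofReal_sum]
  exact Finset.sum_congr rfl fun b _ => by
    rw [Complex.star_def, mul_comm, Complex.mul_conj, Complex.normSq_eq_norm_sq]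

theorem matLog_eq {A : Matrix n n ℂ} (hA : A.IsHermitian) :
    matLog A = (hA.eigenvectorUnitary : Matrix n n ℂ) *
      Matrix.diagonal (fun i => (Real.logb 2 (hA.eigenvalues i) : ℂ)) *
      (hA.eigenvectorUnitary : Matrix n n ℂ)ᴴ := by
  rw [matLog, dif_pos hA]
  congr 3
  ext i
  split_ifs with h
  · simp [h]
  · rfl

/-- Overlaps of two eigenbases. -/
def overlap {A B : Matrix n n ℂ} (hA : A.IsHermitian) (hB : B.IsHermitian) (a b : n) : ℂ :=
  ((hA.eigenvectorUnitary : Matrix n n ℂ)ᴴ * (hB.eigenvectorUnitary : Matrix n n ℂ)) a b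

theorem sum_overlap {A B : Matrix n n ℂ} (hA : A.IsHermitian) (hB : B.IsHermitian) (a : n) :
    ∑ b, ‖overlap hA hB a b‖ ^ 2 = 1 := by
  have h := mul_conjTranspose_diag_re
    ((hA.eigenvectorUnitary : Matrix n n ℂ)ᴴ * (hB.eigenvectorUnitary : Matrix n n ℂ)) a
  rw [Matrix.conjTranspose_mul, Matrix.conjTranspose_conjTranspose, Matrix.mul_assoc,
    ← Matrix.mul_assoc _ _ (hA.eigenvectorUnitary : Matrix n n ℂ),
    eigenvectorUnitary_mul_conjTranspose, Matrix.one_mul, eigenvectorUnitary_conjTranspose_mul,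
    Matrix.one_apply_eq] at h
  exact_mod_cast h.symm

theorem relEnt_trace_eq {ρ σ : Matrix n n ℂ} (hρ : ρ.IsHermitian) (hσ : σ.IsHermitian) :
    Real.log 2 * ((ρ * (matLog ρ - matLog σ)).trace).re =
      ∑ j : n × n, ‖overlap hρ hσ j.1 j.2‖ ^ 2 * hρ.eigenvalues j.1 *
        (Real.log (hρ.eigenvalues j.1) - Real.log (hσ.eigenvalues j.2)) := by
  set U := (hρ.eigenvectorUnitary : Matrix n n ℂ) with hU
  set V := (hσ.eigenvectorUnitary : Matrix n n ℂ) with hV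
  have hU1 : Uᴴ * U = 1 := eigenvectorUnitary_conjTranspose_mul hρ
  have h1 : ((ρ * matLog ρ).trace).re =
      ∑ a, hρ.eigenvalues a * Real.logb 2 (hρ.eigenvalues a) := by
    have : (ρ * matLog ρ).trace =
        ∑ a, (hρ.eigenvalues a : ℂ) * (Uᴴ * matLog ρ * U) a a := by
      rw [← trace_unitary_conj_mul, ← spectral_decomp hρ]
    rw [this, matLog_eq hρ, ← hU]
    have h2 : Uᴴ * (U * Matrix.diagonal (fun i => (Real.logb 2 (hρ.eigenvalues i) : ℂ)) * Uᴴ) * U =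
        Matrix.diagonal (fun i => (Real.logb 2 (hρ.eigenvalues i) : ℂ)) := by
      calc _ = (Uᴴ * U) * Matrix.diagonal (fun i => (Real.logb 2 (hρ.eigenvalues i) : ℂ)) *
            (Uᴴ * U) := by simp only [Matrix.mul_assoc]
        _ = _ := by rw [hU1, Matrix.one_mul, Matrix.mul_one]
    rw [h2, Complex.re_sum]
    refine Finset.sum_congr rfl fun a _ => ?_
    rw [Matrix.diagonal_apply_eq, ← Complex.ofReal_mul, Complex.ofReal_re]
  have h2 : ((ρ * matLog σ).trace).re =
      ∑ a, ∑ b, hρ.eigenvalues a * (‖overlap hρ hσ a b‖ ^ 2 * Real.logb 2 (hσ.eigenvalues b)) := by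
    have : (ρ * matLog σ).trace =
        ∑ a, (hρ.eigenvalues a : ℂ) * (Uᴴ * matLog σ * U) a a := by
      rw [← trace_unitary_conj_mul, ← spectral_decomp hρ]
    rw [this, matLog_eq hσ, ← hV]
    have h2 : Uᴴ * (V * Matrix.diagonal (fun i => (Real.logb 2 (hσ.eigenvalues i) : ℂ)) * Vᴴ) * U =
        (Uᴴ * V) * Matrix.diagonal (fun i => (Real.logb 2 (hσ.eigenvalues i) : ℂ)) *
          (Uᴴ * V)ᴴ := by
      rw [Matrix.conjTranspose_mul, Matrix.conjTranspose_conjTranspose]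
      simp only [Matrix.mul_assoc]
    rw [h2, Complex.re_sum]
    refine Finset.sum_congr rfl fun a _ => ?_
    rw [← Finset.mul_sum, Complex.re_ofReal_mul, Matrix.mul_apply, Complex.re_sum]
    congr 1
    refine Finset.sum_congr rfl fun b _ => ?_
    rw [Matrix.mul_diagonal, Matrix.conjTranspose_apply, mul_right_comm, Complex.star_def,
      Complex.mul_conj, Complex.normSq_eq_norm_sq, ← Complex.ofReal_mul, Complex.ofReal_re]
    rfl
  rw [Matrix.mul_sub, Matrix.trace_sub, Complex.sub_re, h1, h2, Fintype.sum_prod_type, mul_sub,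
    Finset.mul_sum, Finset.mul_sum, ← Finset.sum_sub_distrib]
  refine Finset.sum_congr rfl fun a _ => ?_
  have hl : Real.log 2 ≠ 0 := by positivity
  have h3 : ∑ b, ‖overlap hρ hσ a b‖ ^ 2 * hρ.eigenvalues a * Real.log (hρ.eigenvalues a) =
      hρ.eigenvalues a * Real.log (hρ.eigenvalues a) := by
    rw [← Finset.sum_mul, ← Finset.sum_mul, sum_overlap, one_mul]
  simp only [mul_sub, Finset.sum_sub_distrib]
  rw [h3]
  congr 1
  · rw [Real.logb]; field_simp
  · rw [Finset.mul_sum]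
    refine Finset.sum_congr rfl fun b _ => ?_
    rw [Real.logb]; field_simp

theorem quadratic_le {ρ σ C : Matrix n n ℂ} (hρ : ρ.PosSemidef) (hσ : σ.PosSemidef)
    (hC : C.IsHermitian) {t : ℝ} (ht : 0 ≤ t)
    (hsupp : ∀ j : n × n, ‖overlap hρ.1 hσ.1 j.1 j.2‖ ^ 2 * hρ.1.eigenvalues j.1 ≠ 0 →
      0 < hσ.1.eigenvalues j.2) :
    2 * ((ρ * C).trace).re - ((σ * (C * C)).trace).re - t * ((ρ * (C * C)).trace).re ≤
      ∑ j : n × n, ‖overlap hρ.1 hσ.1 j.1 j.2‖ ^ 2 * hρ.1.eigenvalues j.1 ^ 2 /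
        (hσ.1.eigenvalues j.2 + t * hρ.1.eigenvalues j.1) := by
  set U := (hρ.1.eigenvectorUnitary : Matrix n n ℂ) with hU
  set V := (hσ.1.eigenvectorUnitary : Matrix n n ℂ) with hV
  have hU2 : U * Uᴴ = 1 := eigenvectorUnitary_mul_conjTranspose hρ.1
  have hV2 : V * Vᴴ = 1 := eigenvectorUnitary_mul_conjTranspose hσ.1
  set X := Vᴴ * C * U with hX
  have hXh : Xᴴ = Uᴴ * C * V := by
    rw [hX]; simp only [Matrix.conjTranspose_mul, Matrix.conjTranspose_conjTranspose, hC.eq,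
      Matrix.mul_assoc]
  have hr0 := hρ.eigenvalues_nonneg
  have hs0 := hσ.eigenvalues_nonneg
  have h1 : ((ρ * C).trace).re =
      ∑ a, ∑ b, hρ.1.eigenvalues a * (overlap hρ.1 hσ.1 a b * X b a).re := by
    have : (ρ * C).trace = ∑ a, (hρ.1.eigenvalues a : ℂ) * (Uᴴ * C * U) a a := by
      rw [← trace_unitary_conj_mul, ← spectral_decomp hρ.1]
    have h2 : Uᴴ * C * U = (Uᴴ * V) * X := by
      rw [hX, Matrix.mul_assoc, Matrix.mul_assoc Uᴴ V, ← Matrix.mul_assoc V, ← Matrix.mul_assoc V,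
        hV2, Matrix.one_mul]
    rw [this, h2, Complex.re_sum]
    refine Finset.sum_congr rfl fun a _ => ?_
    rw [Complex.re_ofReal_mul, Matrix.mul_apply, Complex.re_sum, Finset.mul_sum]
    rfl
  have h2 : ((ρ * (C * C)).trace).re = ∑ a, ∑ b, hρ.1.eigenvalues a * ‖X b a‖ ^ 2 := by
    have : (ρ * (C * C)).trace = ∑ a, (hρ.1.eigenvalues a : ℂ) * (Uᴴ * (C * C) * U) a a := by
      rw [← trace_unitary_conj_mul, ← spectral_decomp hρ.1]
    have h2 : Uᴴ * (C * C) * U = Xᴴ * X := by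
      calc Uᴴ * (C * C) * U = Uᴴ * C * (V * Vᴴ) * C * U := by
            rw [hV2, Matrix.mul_one]; simp only [Matrix.mul_assoc]
        _ = Xᴴ * X := by rw [hXh, hX]; simp only [Matrix.mul_assoc]
    rw [this, h2, Complex.re_sum]
    refine Finset.sum_congr rfl fun a _ => ?_
    rw [conjTranspose_mul_diag_re, ← Complex.ofReal_mul, Complex.ofReal_re, Finset.mul_sum]
  have h3 : ((σ * (C * C)).trace).re = ∑ a, ∑ b, hσ.1.eigenvalues b * ‖X b a‖ ^ 2 := by
    have : (σ * (C * C)).trace = ∑ a, (hσ.1.eigenvalues a : ℂ) * (Vᴴ * (C * C) * V) a a := by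
      rw [← trace_unitary_conj_mul, ← spectral_decomp hσ.1]
    have h2 : Vᴴ * (C * C) * V = X * Xᴴ := by
      calc Vᴴ * (C * C) * V = Vᴴ * C * (U * Uᴴ) * C * V := by
            rw [hU2, Matrix.mul_one]; simp only [Matrix.mul_assoc]
        _ = X * Xᴴ := by rw [hXh, hX]; simp only [Matrix.mul_assoc]
    rw [this, h2, Complex.re_sum, Finset.sum_comm]
    refine Finset.sum_congr rfl fun a _ => ?_
    rw [mul_conjTranspose_diag_re, ← Complex.ofReal_mul, Complex.ofReal_re, Finset.mul_sum]
  rw [h1, h2, h3, Fintype.sum_prod_type]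
  simp only [Finset.mul_sum, ← Finset.sum_sub_distrib]
  refine Finset.sum_le_sum fun a _ => Finset.sum_le_sum fun b _ => ?_
  set o := overlap hρ.1 hσ.1 a b with ho
  set r := hρ.1.eigenvalues a with hr
  set s := hσ.1.eigenvalues b with hs
  have hr0 : 0 ≤ r := hr0 a
  have hs0 : 0 ≤ s := hs0 b
  have hre : (o * X b a).re ≤ ‖o‖ * ‖X b a‖ :=
    (Complex.re_le_norm _).trans (norm_mul_le _ _)
  have hre' : r * (o * X b a).re ≤ r * (‖o‖ * ‖X b a‖) := mul_le_mul_of_nonneg_left hre hr0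
  by_cases hz : ‖o‖ ^ 2 * r = 0
  · have h4 : ‖o‖ ^ 2 * r ^ 2 = 0 := by rw [pow_two r, ← mul_assoc, hz, zero_mul]
    have h5 : r * (‖o‖ * ‖X b a‖) = 0 := by
      rcases mul_eq_zero.mp hz with h | h
      · rw [pow_eq_zero_iff two_ne_zero] at h
        rw [h]; ring
      · rw [h]; ring
    rw [h4, zero_div]
    have : 0 ≤ s * ‖X b a‖ ^ 2 + t * (r * ‖X b a‖ ^ 2) := by positivity
    linarith
  · have hs' : 0 < s := hsupp (a, b) hz
    have hpos : 0 < s + t * r := by positivity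
    rw [le_div_iff₀ hpos]
    nlinarith [sq_nonneg ((s + t * r) * ‖X b a‖ - r * ‖o‖),
      mul_le_mul_of_nonneg_right hre' hpos.le]

theorem eigenvalue_pos_of_suppLE {ρ σ : Matrix n n ℂ} (hρ : ρ.PosSemidef) (hσ : σ.PosSemidef)
    (h : suppLE ρ σ) (j : n × n)
    (hj : ‖overlap hρ.1 hσ.1 j.1 j.2‖ ^ 2 * hρ.1.eigenvalues j.1 ≠ 0) :
    0 < hσ.1.eigenvalues j.2 := by
  refine (hσ.eigenvalues_nonneg j.2).lt_of_ne' fun h0 => hj ?_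
  set U := (hρ.1.eigenvectorUnitary : Matrix n n ℂ) with hU
  set V := (hσ.1.eigenvectorUnitary : Matrix n n ℂ) with hV
  have hU1 : Uᴴ * U = 1 := eigenvectorUnitary_conjTranspose_mul hρ.1
  have h1 : ρ.mulVec ⇑(hσ.1.eigenvectorBasis j.2) = 0 := by
    apply h
    rw [hσ.1.mulVec_eigenvectorBasis, h0, zero_smul]
  have h2 : (Uᴴ * ρ * V) j.1 j.2 = 0 := by
    rw [Matrix.mul_assoc, Matrix.mul_apply]
    refine Finset.sum_eq_zero fun i _ => ?_
    have : (ρ * V) i j.2 = (ρ.mulVec ⇑(hσ.1.eigenvectorBasis j.2)) i := rfl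
    rw [this, h1, Pi.zero_apply, mul_zero]
  have h3 : Uᴴ * ρ * V = Matrix.diagonal (fun i => (hρ.1.eigenvalues i : ℂ)) * (Uᴴ * V) := by
    conv_lhs => rw [spectral_decomp hρ.1]
    rw [← hU, ← Matrix.mul_assoc, ← Matrix.mul_assoc, hU1, Matrix.one_mul, Matrix.mul_assoc]
  rw [h3, Matrix.diagonal_mul] at h2
  rcases mul_eq_zero.mp h2 with h4 | h4
  · rw [Complex.ofReal_eq_zero.mp h4, mul_zero]
  · have : overlap hρ.1 hσ.1 j.1 j.2 = 0 := h4
    rw [this]; simp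

/-- Kadison-type inequality `(∑ c M)² ≤ ∑ c² M` for a POVM. -/
theorem posSemidef_sum_sq_sub {X : Type*} [Fintype X] {M : X → Matrix n n ℂ}
    (hM : ∀ x, (M x).PosSemidef) (hM1 : ∑ x, M x = 1) (c : X → ℝ) :
    (∑ x, ((c x ^ 2 : ℝ) : ℂ) • M x - (∑ x, (c x : ℂ) • M x) * ∑ x, (c x : ℂ) • M x).PosSemidef := by
  set C := ∑ x, (c x : ℂ) • M x with hC
  have hCh : Cᴴ = C := by
    rw [hC, Matrix.conjTranspose_sum]
    refine Finset.sum_congr rfl fun x _ => ?_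
    rw [Matrix.conjTranspose_smul, (hM x).1.eq]; simp
  have h : ∑ x, ((c x ^ 2 : ℝ) : ℂ) • M x - C * C =
      ∑ x, ((c x : ℂ) • (1 : Matrix n n ℂ) - C) * M x * ((c x : ℂ) • (1 : Matrix n n ℂ) - C)ᴴ := by
    have : ∀ x, ((c x : ℂ) • (1 : Matrix n n ℂ) - C) * M x *
        ((c x : ℂ) • (1 : Matrix n n ℂ) - C)ᴴ = ((c x ^ 2 : ℝ) : ℂ) • M x - ((c x : ℂ) • M x) * C
          - C * ((c x : ℂ) • M x) + C * M x * C := by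
      intro x
      rw [Matrix.conjTranspose_sub, hCh, Matrix.conjTranspose_smul, Matrix.conjTranspose_one]
      simp only [Matrix.sub_mul, Matrix.mul_sub, Matrix.smul_mul, Matrix.mul_smul, Matrix.one_mul,
        Matrix.mul_one, Complex.star_def, Complex.conj_ofReal, smul_sub, smul_smul]
      push_cast
      rw [pow_two]
      abel
    simp only [this, Finset.sum_add_distrib, Finset.sum_sub_distrib, ← Finset.sum_mul,
      ← Finset.mul_sum, hM1, Matrix.mul_one, ← hC]
    abel
  rw [h]
  exact Matrix.posSemidef_sum _ fun x _ => (hM x).mul_mul_conjTranspose_same _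

/-- Variational lower bound on the relative entropy by measurement statistics. -/
theorem measurement_le_relEnt {X : Type*} [Fintype X] {ρ σ : Matrix n n ℂ}
    (hρ : ρ.PosSemidef) (hρ1 : ρ.trace = 1) (hσ : σ.PosSemidef) (h : suppLE ρ σ)
    {M : X → Matrix n n ℂ} (hM : ∀ x, (M x).PosSemidef) (hM1 : ∑ x, M x = 1)
    {v : X → ℝ} (hv : ∀ x, 0 < v x) :
    ∑ x, ((M x * ρ).trace).re * Real.log (v x) + 1 - ∑ x, ((M x * σ).trace).re * v x ≤
      Real.log 2 * ((ρ * (matLog ρ - matLog σ)).trace).re := by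
  have hsum : ∑ x, ((M x * ρ).trace).re = 1 := by
    rw [← Complex.re_sum, ← Matrix.trace_sum, ← Finset.sum_mul, hM1, Matrix.one_mul, hρ1,
      Complex.one_re]
  have hr1 : ∑ a, hρ.1.eigenvalues a = 1 := by
    have := hρ.1.trace_eq_sum_eigenvalues
    rw [hρ1] at this
    apply Complex.ofReal_injective
    rw [Complex.ofReal_sum, Complex.ofReal_one]
    exact this.symm
  have hlin : ∀ (τ : Matrix n n ℂ) (c : X → ℝ),
      ((τ * ∑ x, (c x : ℂ) • M x).trace).re = ∑ x, c x * ((M x * τ).trace).re := by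
    intro τ c
    rw [Finset.mul_sum, Matrix.trace_sum, Complex.re_sum]
    refine Finset.sum_congr rfl fun x _ => ?_
    rw [Matrix.mul_smul, Matrix.trace_smul, smul_eq_mul, Complex.re_ofReal_mul,
      Matrix.trace_mul_comm]
  rw [relEnt_trace_eq hρ.1 hσ.1]
  have key := classical_le_of_quadratic_le
    (fun j : n × n => ‖overlap hρ.1 hσ.1 j.1 j.2‖ ^ 2) (fun j => hρ.1.eigenvalues j.1)
    (fun j => hσ.1.eigenvalues j.2) (fun j => by positivity) (fun j => hρ.eigenvalues_nonneg _)
    (fun j => hσ.eigenvalues_nonneg _) (eigenvalue_pos_of_suppLE hρ hσ h)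
    (fun x => ((M x * ρ).trace).re) (fun x => ((M x * σ).trace).re) v
    (fun x => re_trace_mul_nonneg (hM x) hρ) (fun x => re_trace_mul_nonneg (hM x) hσ) hv ?_ ?_
  · rwa [hsum] at key
  · rw [hsum, Fintype.sum_prod_type]
    simp only [← Finset.sum_mul, sum_overlap, one_mul, hr1]
  · intro t ht c
    set C := ∑ x, (c x : ℂ) • M x with hC
    have hCh : C.IsHermitian := by
      refine (Matrix.conjTranspose_sum _ _).trans (Finset.sum_congr rfl fun x _ => ?_)
      rw [Matrix.conjTranspose_smul, (hM x).1.eq]; simp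
    refine le_trans ?_ (quadratic_le hρ hσ hCh ht (eigenvalue_pos_of_suppLE hρ hσ h))
    have hK := posSemidef_sum_sq_sub hM hM1 c
    have h1 := re_trace_mul_le hρ hK
    have h2 := re_trace_mul_le hσ hK
    rw [hlin ρ (fun x => c x ^ 2)] at h1
    rw [hlin σ (fun x => c x ^ 2)] at h2
    rw [← hC] at h1 h2
    have h3 := mul_le_mul_of_nonneg_left h1 ht
    rw [hC, hlin ρ c, ← hC]
    linarith

/-! ### Partial transposes and tensor powers -/

section Bipartite

variable {α β : Type*}

theorem ptB_add (X Y : Matrix (α × β) (α × β) ℂ) : ptB (X + Y) = ptB X + ptB Y := rfl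

theorem ptB_isHermitian {X : Matrix (α × β) (α × β) ℂ} (hX : X.IsHermitian) :
    (ptB X).IsHermitian := by
  ext p q
  exact congrFun (congrFun hX (p.1, q.2)) (q.1, p.2)

theorem trace_ptB_mul [Fintype α] [Fintype β] (X Y : Matrix (α × β) (α × β) ℂ) :
    (ptB X * Y).trace = (X * ptB Y).trace := by
  simp only [Matrix.trace, Matrix.diag_apply, Matrix.mul_apply, ptB, Matrix.of_apply,
    Fintype.sum_prod_type]
  refine Finset.sum_congr rfl fun a _ => ?_
  rw [Finset.sum_comm]
  conv_rhs => rw [Finset.sum_comm]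
  exact Finset.sum_congr rfl fun a' _ => Finset.sum_comm

/-- Tensor product of finitely many bipartite matrices, with all `α` factors on one side. -/
def tensorBip {N : ℕ} (X : Fin N → Matrix (α × β) (α × β) ℂ) :
    Matrix ((Fin N → α) × (Fin N → β)) ((Fin N → α) × (Fin N → β)) ℂ :=
  Matrix.of fun p q => ∏ i, X i (p.1 i, p.2 i) (q.1 i, q.2 i)

theorem ptB_tensorBip {N : ℕ} (X : Fin N → Matrix (α × β) (α × β) ℂ) :
    ptB (tensorBip X) = tensorBip fun i => ptB (X i) := rfl

theorem tensorBip_conjTranspose {N : ℕ} (X : Fin N → Matrix (α × β) (α × β) ℂ) :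
    (tensorBip X)ᴴ = tensorBip fun i => (X i)ᴴ := by
  ext p q
  simp [tensorBip, Matrix.conjTranspose_apply]

theorem tensorBip_smul {N : ℕ} (c : Fin N → ℂ) (X : Fin N → Matrix (α × β) (α × β) ℂ) :
    tensorBip (fun i => c i • X i) = (∏ i, c i) • tensorBip X := by
  ext p q
  simp [tensorBip, Finset.prod_mul_distrib]

theorem tensorBip_sum {N : ℕ} {Y : Type*} [Fintype Y]
    (X : Fin N → Y → Matrix (α × β) (α × β) ℂ) :
    tensorBip (fun i => ∑ y, X i y) = ∑ f : Fin N → Y, tensorBip fun i => X i (f i) := by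
  ext p q
  simp only [tensorBip, Matrix.of_apply, Matrix.sum_apply]
  rw [Finset.prod_univ_sum, Fintype.piFinset_univ]

theorem tensorBip_one {N : ℕ} [DecidableEq α] [DecidableEq β] :
    tensorBip (fun _ : Fin N => (1 : Matrix (α × β) (α × β) ℂ)) = 1 := by
  ext p q
  by_cases h : p = q
  · subst h
    rw [Matrix.one_apply_eq]
    simp [tensorBip]
  · rw [Matrix.one_apply_ne h]
    have hne : ∃ i, (p.1 i, p.2 i) ≠ (q.1 i, q.2 i) := by
      by_contra! hall
      exact h (Prod.ext (funext fun i => congrArg Prod.fst (hall i))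
        (funext fun i => congrArg Prod.snd (hall i)))
    obtain ⟨i, hi⟩ := hne
    exact Finset.prod_eq_zero (Finset.mem_univ i) (Matrix.one_apply_ne hi)

variable [Fintype α] [Fintype β]

theorem prod_sum_pair {N : ℕ} (F : Fin N → α × β → ℂ) :
    ∏ i, ∑ x, F i x = ∑ r : (Fin N → α) × (Fin N → β), ∏ i, F i (r.1 i, r.2 i) := by
  have h := Finset.prod_univ_sum (fun _ : Fin N => (Finset.univ : Finset (α × β))) F
  rw [Fintype.piFinset_univ] at h
  rw [h]
  exact Fintype.sum_equiv (Equiv.arrowProdEquivProdArrow (Fin N) (fun _ => α) (fun _ => β)) _ _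
    fun _ => rfl

theorem tensorBip_mul {N : ℕ} (X Y : Fin N → Matrix (α × β) (α × β) ℂ) :
    tensorBip X * tensorBip Y = tensorBip fun i => X i * Y i := by
  ext p q
  simp only [tensorBip, Matrix.of_apply, Matrix.mul_apply, ← Finset.prod_mul_distrib]
  exact (prod_sum_pair fun i x =>
    X i (p.1 i, p.2 i) x * Y i x (q.1 i, q.2 i)).symm

theorem trace_tensorBip {N : ℕ} (X : Fin N → Matrix (α × β) (α × β) ℂ) :
    (tensorBip X).trace = ∏ i, (X i).trace := by
  simp only [Matrix.trace, Matrix.diag_apply]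
  exact (prod_sum_pair fun i x => X i x x).symm

theorem tensorBip_posSemidef {N : ℕ} {X : Fin N → Matrix (α × β) (α × β) ℂ}
    (hX : ∀ i, (X i).PosSemidef) : (tensorBip X).PosSemidef := by
  choose C hC using fun i => exists_eq_conjTranspose_mul_self (hX i)
  have : tensorBip X = (tensorBip C)ᴴ * tensorBip C := by
    rw [tensorBip_conjTranspose, tensorBip_mul]
    exact congrArg tensorBip (funext hC)
  rw [this]
  exact Matrix.posSemidef_conjTranspose_mul_self _

theorem tensorBip_add_posSemidef {N : ℕ} {T D : Matrix (α × β) (α × β) ℂ}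
    (h₁ : (T - D).PosSemidef) (h₂ : (T + D).PosSemidef) {e : ℝ} (he : e = 1 ∨ e = -1) :
    (tensorBip (fun _ : Fin N => T) + (e : ℂ) • tensorBip (fun _ : Fin N => D)).PosSemidef := by
  set A : Bool → Matrix (α × β) (α × β) ℂ := fun b =>
    (2⁻¹ : ℝ) • (if b then T + D else T - D) with hA
  set ε : Bool → ℝ := fun b => if b then 1 else -1 with hε
  have hAp : ∀ b, (A b).PosSemidef := by
    intro b
    refine Matrix.PosSemidef.smul ?_ (by positivity : (0 : ℝ) ≤ 2⁻¹)
    cases b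
    · simpa using h₁
    · simpa using h₂
  have hT : T = ∑ b, A b := by
    simp only [hA, Fintype.sum_bool, if_true, Bool.false_eq_true, if_false]
    module
  have hD : D = ∑ b, (ε b : ℂ) • A b := by
    simp only [hA, hε, Fintype.sum_bool, if_true, Bool.false_eq_true, if_false]
    push_cast
    module
  have hT' : tensorBip (fun _ : Fin N => T) = ∑ f : Fin N → Bool, tensorBip fun i => A (f i) := by
    rw [hT]; exact tensorBip_sum _
  have hD' : tensorBip (fun _ : Fin N => D) =
      ∑ f : Fin N → Bool, ((∏ i, ε (f i) : ℝ) : ℂ) • tensorBip fun i => A (f i) := by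
    conv_lhs => rw [hD]
    rw [tensorBip_sum]
    refine Finset.sum_congr rfl fun f _ => ?_
    rw [tensorBip_smul]; push_cast; rfl
  rw [hT', hD', Finset.smul_sum, ← Finset.sum_add_distrib]
  refine Matrix.posSemidef_sum _ fun f _ => ?_
  have habs : |∏ i, ε (f i)| ≤ 1 := by
    rw [Finset.abs_prod]
    refine le_of_eq (Finset.prod_eq_one fun i _ => ?_)
    simp only [hε]; split_ifs <;> simp
  have h0 : 0 ≤ 1 + e * ∏ i, ε (f i) := by
    rw [abs_le] at habs
    rcases he with rfl | rfl <;> linarith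
  have := (tensorBip_posSemidef fun i => hAp (f i)).smul h0
  convert this using 1
  rw [add_smul, one_smul, smul_smul, ← Complex.ofReal_mul, Complex.coe_smul]

theorem tensorBip_abs_le {N : ℕ} {T D : Matrix (α × β) (α × β) ℂ}
    (h₁ : (T - D).PosSemidef) (h₂ : (T + D).PosSemidef) :
    (tensorBip (fun _ : Fin N => T) - tensorBip (fun _ : Fin N => D)).PosSemidef ∧
      (tensorBip (fun _ : Fin N => T) + tensorBip (fun _ : Fin N => D)).PosSemidef := by
  constructor
  · have := tensorBip_add_posSemidef (N := N) h₁ h₂ (e := -1) (Or.inr rfl)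
    simpa [sub_eq_add_neg] using this
  · have := tensorBip_add_posSemidef (N := N) h₁ h₂ (e := 1) (Or.inl rfl)
    simpa using this

variable [DecidableEq α] [DecidableEq β]

/-- Dual certificate for the bound `tr Wσ ≤ s` on all of `PPT_k`. -/
structure IsDualCert (k : ℕ) (W : Matrix (α × β) (α × β) ℂ)
    (D : ℕ → Matrix (α × β) (α × β) ℂ) (s : ℝ) : Prop where
  pos : 0 < s
  posSemidef : W.PosSemidef
  le_first : (ptB (D 1) - W).PosSemidef
  step : ∀ i ∈ Finset.Icc 1 (k - 1),
    (ptB (D (i + 1)) - D i).PosSemidef ∧ (ptB (D (i + 1)) + D i).PosSemidef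
  last : ((s : ℂ) • (1 : Matrix (α × β) (α × β) ℂ) - D k).PosSemidef ∧
    ((s : ℂ) • (1 : Matrix (α × β) (α × β) ℂ) + D k).PosSemidef

theorem IsDualCert.tensorPow {k : ℕ} {W : Matrix (α × β) (α × β) ℂ}
    {D : ℕ → Matrix (α × β) (α × β) ℂ} {s : ℝ} (h : IsDualCert k W D s) (N : ℕ) :
    IsDualCert k (tensorBip fun _ : Fin N => W) (fun j => tensorBip fun _ : Fin N => D j)
      (s ^ N) := by
  have h2 : (ptB (D 1) + W).PosSemidef := by
    convert (h.le_first.add h.posSemidef).add h.posSemidef using 1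
    abel
  have hlast := tensorBip_abs_le (N := N) h.last.1 h.last.2
  have hone : tensorBip (fun _ : Fin N => (s : ℂ) • (1 : Matrix (α × β) (α × β) ℂ)) =
      ((s ^ N : ℝ) : ℂ) • 1 := by
    rw [tensorBip_smul (fun _ => (s : ℂ)), tensorBip_one]
    simp
  rw [hone] at hlast
  refine ⟨pow_pos h.pos N, tensorBip_posSemidef fun _ => h.posSemidef,
    (tensorBip_abs_le h.le_first h2).1, fun i hi => ?_, hlast⟩
  simp only [ptB_tensorBip]
  exact tensorBip_abs_le (h.step i hi).1 (h.step i hi).2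

theorem IsDualCert.re_trace_le {k : ℕ} (hk : 1 ≤ k) {W : Matrix (α × β) (α × β) ℂ}
    {D : ℕ → Matrix (α × β) (α × β) ℂ} {s : ℝ} (h : IsDualCert k W D s)
    {τ : Matrix (α × β) (α × β) ℂ} (hτ : memPPTk k τ) : ((W * τ).trace).re ≤ s := by
  obtain ⟨hτ0, ω, hω1, hωh, hωs, hωk⟩ := hτ
  have chain : ∀ i, 1 ≤ i → i ≤ k → ((τ * W).trace).re ≤ ((ω i * ptB (D i)).trace).re := by
    intro i hi
    induction i, hi using Nat.le_induction with
    | base =>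
      intro _
      rw [hω1]
      exact re_trace_mul_le hτ0 h.le_first
    | succ i hi ih =>
      intro hik
      refine (ih (by omega)).trans ?_
      have hmem : i ∈ Finset.Icc 1 (k - 1) := Finset.mem_Icc.mpr ⟨hi, by omega⟩
      rw [← trace_ptB_mul]
      exact re_trace_mul_le_of_abs_le (hωs i hmem).1 (hωs i hmem).2 (h.step i hmem).1
        (h.step i hmem).2
  rw [Matrix.trace_mul_comm]
  refine (chain k hk le_rfl).trans ?_
  rw [← trace_ptB_mul]
  have hh := ptB_isHermitian (hωh k (Finset.mem_Icc.mpr ⟨hk, le_rfl⟩))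
  refine (re_trace_mul_le_traceNorm hh h.pos h.last.1 h.last.2).trans ?_
  exact (mul_le_mul_of_nonneg_left hωk h.pos.le).trans (mul_one s).le

end Bipartite

theorem trace_mul_eq_ofReal_re {ι : Type*} [Fintype ι] {A B : Matrix ι ι ℂ}
    (hA : A.IsHermitian) (hB : B.IsHermitian) :
    (A * B).trace = (((A * B).trace).re : ℂ) := by
  refine (Complex.conj_eq_iff_re.mp ?_).symm
  rw [← Complex.star_def, ← Matrix.trace_conjTranspose, Matrix.conjTranspose_mul, hA.eq, hB.eq,
    Matrix.trace_mul_comm]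

theorem sum_prod_mul_sum {N : ℕ} {X : Type*} [Fintype X] (p g : X → ℝ) (hp : ∑ x, p x = 1) :
    ∑ f : Fin N → X, (∏ i, p (f i)) * ∑ i, g (f i) = N * ∑ x, p x * g x := by
  have h : ∀ j : Fin N, ∑ f : Fin N → X, (∏ i, p (f i)) * g (f j) = ∑ x, p x * g x := by
    intro j
    have h1 := Finset.prod_univ_sum (fun _ : Fin N => (Finset.univ : Finset X))
      (fun i x => p x * if i = j then g x else 1)
    rw [Fintype.piFinset_univ] at h1
    simp only [Finset.prod_mul_distrib, Finset.prod_ite_eq', Finset.mem_univ, if_true] at h1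
    rw [← h1, Finset.prod_eq_single j]
    · simp
    · intro i _ hij
      simp [hij, hp]
    · simp
  simp only [Finset.mul_sum]
  rw [Finset.sum_comm]
  simp only [h, ← Finset.mul_sum]
  simp

/-- A certified test on one copy bounds the relative entropy of `N` copies from below. -/
theorem IsDualCert.mul_le_relEnt {dA dB : ℕ} {k : ℕ} (hk : 1 ≤ k)
    {ρ : Matrix (Fin dA × Fin dB) (Fin dA × Fin dB) ℂ}
    (hρ : ρ.PosSemidef) (hρ1 : ρ.trace = 1) {m : ℕ}
    {M : Fin m → Matrix (Fin dA × Fin dB) (Fin dA × Fin dB) ℂ}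
    (hM : ∀ x, (M x).PosSemidef) (hM1 : ∑ x, M x = 1) {w : Fin m → ℝ} (hw : ∀ x, 0 < w x)
    {D : ℕ → Matrix (Fin dA × Fin dB) (Fin dA × Fin dB) ℂ} {s : ℝ}
    (hcert : IsDualCert k (∑ x, (w x : ℂ) • M x) D s) (N : ℕ)
    {τ : Matrix ((Fin N → Fin dA) × (Fin N → Fin dB)) ((Fin N → Fin dA) × (Fin N → Fin dB)) ℂ}
    (hτ : memPPTk k τ) (hsupp : suppLE (kronPowBip N ρ) τ) :
    N * (∑ x, ((M x * ρ).trace).re * Real.log (w x) - Real.log s) ≤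
      Real.log 2 * ((kronPowBip N ρ * (matLog (kronPowBip N ρ) - matLog τ)).trace).re := by
  have hs := hcert.pos
  have hpow : kronPowBip N ρ = tensorBip fun _ : Fin N => ρ := rfl
  have hp1 : ∑ x, ((M x * ρ).trace).re = 1 := by
    rw [← Complex.re_sum, ← Matrix.trace_sum, ← Finset.sum_mul, hM1, Matrix.one_mul, hρ1,
      Complex.one_re]
  have hmeas := measurement_le_relEnt (X := Fin N → Fin m)
    (hpow ▸ tensorBip_posSemidef fun _ => hρ : (kronPowBip N ρ).PosSemidef)
    (by rw [hpow, trace_tensorBip]; simp [hρ1]) hτ.1 hsupp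
    (M := fun f => tensorBip fun i => M (f i))
    (fun f => tensorBip_posSemidef fun i => hM (f i))
    (by rw [← tensorBip_sum (fun (_ : Fin N) x => M x)]; simp only [hM1]; exact tensorBip_one)
    (v := fun f => (∏ i, w (f i)) / s ^ N)
    (fun f => div_pos (Finset.prod_pos fun i _ => hw _) (pow_pos hs N))
  have hP : ∀ f : Fin N → Fin m, ((tensorBip (fun i => M (f i)) * kronPowBip N ρ).trace).re =
      ∏ i, ((M (f i) * ρ).trace).re := by
    intro f
    rw [hpow, tensorBip_mul, trace_tensorBip,
      Finset.prod_congr rfl fun i _ => trace_mul_eq_ofReal_re (hM (f i)).1 hρ.1,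
      ← Complex.ofReal_prod, Complex.ofReal_re]
  have hlog : ∀ f : Fin N → Fin m, Real.log ((∏ i, w (f i)) / s ^ N) =
      ∑ i, (Real.log (w (f i)) - Real.log s) := by
    intro f
    rw [Real.log_div (Finset.prod_pos fun i _ => hw _).ne' (pow_pos hs N).ne', Real.log_pow,
      Real.log_prod fun i _ => (hw _).ne', Finset.sum_sub_distrib]
    simp
  have hW : ∑ f : Fin N → Fin m, ((tensorBip (fun i => M (f i)) * τ).trace).re *
      ((∏ i, w (f i)) / s ^ N) ≤ 1 := by
    have h1 := (hcert.tensorPow N).re_trace_le hk hτ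
    rw [tensorBip_sum (fun (_ : Fin N) x => (w x : ℂ) • M x), Finset.sum_mul, Matrix.trace_sum,
      Complex.re_sum] at h1
    have h2 : ∀ f : Fin N → Fin m, ((tensorBip (fun i => (w (f i) : ℂ) • M (f i)) * τ).trace).re =
        (∏ i, w (f i)) * ((tensorBip (fun i => M (f i)) * τ).trace).re := by
      intro f
      rw [tensorBip_smul, Matrix.smul_mul, Matrix.trace_smul, ← Complex.ofReal_prod, smul_eq_mul,
        Complex.re_ofReal_mul]
    simp only [h2] at h1
    have h3 := div_le_one_of_le₀ h1 (pow_pos hs N).le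
    rw [Finset.sum_div] at h3
    refine (le_of_eq (Finset.sum_congr rfl fun f _ => ?_)).trans h3
    ring
  simp only [hP, hlog] at hmeas
  rw [sum_prod_mul_sum _ (fun x => Real.log (w x) - Real.log s) hp1] at hmeas
  simp only [mul_sub, Finset.sum_sub_distrib, ← Finset.sum_mul, hp1, one_mul] at hmeas ⊢
  linarith


/-! ### Linear programming duality for the `PPT_k` set -/

section Duality

/-- A weighted POVM of total weight `l`, with weighted sum `W` and expected log-weight `r`. -/
def IsWeightedTest (ρ W : Matrix n n ℂ) (l r : ℝ) : Prop :=
  0 ≤ l ∧ ∃ (m : ℕ) (M : Fin m → Matrix n n ℂ) (w : Fin m → ℝ),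
    (∀ x, (M x).PosSemidef) ∧ (∀ x, 0 < w x) ∧ ∑ x, M x = l • (1 : Matrix n n ℂ) ∧
      W = ∑ x, (w x : ℂ) • M x ∧ r = ∑ x, ((M x * ρ).trace).re * Real.log (w x)

theorem IsWeightedTest.zero (ρ : Matrix n n ℂ) : IsWeightedTest ρ 0 0 0 :=
  ⟨le_rfl, 0, Fin.elim0, Fin.elim0, fun x => x.elim0, fun x => x.elim0, by simp, by simp, by simp⟩

theorem IsWeightedTest.add {ρ W W' : Matrix n n ℂ} {l l' r r' : ℝ} (h : IsWeightedTest ρ W l r)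
    (h' : IsWeightedTest ρ W' l' r') : IsWeightedTest ρ (W + W') (l + l') (r + r') := by
  obtain ⟨hl, m, M, w, hM, hw, hM1, rfl, rfl⟩ := h
  obtain ⟨hl', m', M', w', hM', hw', hM1', rfl, rfl⟩ := h'
  refine ⟨add_nonneg hl hl', m + m', Fin.append M M', Fin.append w w', ?_, ?_, ?_, ?_, ?_⟩
  · intro x
    refine Fin.addCases (fun i => ?_) (fun i => ?_) x
    · simpa using hM i
    · simpa using hM' i
  · intro x
    refine Fin.addCases (fun i => ?_) (fun i => ?_) x
    · simpa using hw i
    · simpa using hw' i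
  · simp [Fin.sum_univ_add, hM1, hM1', add_smul]
  · simp [Fin.sum_univ_add]
  · simp [Fin.sum_univ_add]

theorem IsWeightedTest.smul {ρ W : Matrix n n ℂ} {l r a : ℝ} (h : IsWeightedTest ρ W l r)
    (ha : 0 ≤ a) : IsWeightedTest ρ (a • W) (a * l) (a * r) := by
  obtain ⟨hl, m, M, w, hM, hw, hM1, rfl, rfl⟩ := h
  refine ⟨mul_nonneg ha hl, m, fun x => a • M x, w, fun x => (hM x).smul ha, hw, ?_, ?_, ?_⟩
  · rw [← Finset.smul_sum, hM1, smul_smul]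
  · rw [Finset.smul_sum]
    exact Finset.sum_congr rfl fun x _ => smul_comm _ _ _
  · rw [Finset.mul_sum]
    refine Finset.sum_congr rfl fun x _ => ?_
    rw [Matrix.smul_mul, Matrix.trace_smul, Complex.smul_re, smul_eq_mul, mul_assoc]

theorem eq_zero_of_sum_posSemidef_eq_zero {ι : Type*} [Fintype ι]
    {m : ℕ} {M : Fin m → Matrix ι ι ℂ}
    (hM : ∀ x, (M x).PosSemidef) (h : ∑ x, M x = 0) (x : Fin m) : M x = 0 := by
  have h1 : ∑ x, (M x).trace = 0 := by rw [← Matrix.trace_sum, h, Matrix.trace_zero]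
  rw [Finset.sum_eq_zero_iff_of_nonneg fun x _ => (hM x).trace_nonneg] at h1
  exact (hM x).trace_eq_zero_iff.mp (h1 x (Finset.mem_univ x))

theorem IsWeightedTest.eq_zero {ρ W : Matrix n n ℂ} {r : ℝ} (h : IsWeightedTest ρ W 0 r) :
    r = 0 := by
  obtain ⟨-, m, M, w, hM, -, hM1, -, rfl⟩ := h
  rw [zero_smul] at hM1
  simp [eq_zero_of_sum_posSemidef_eq_zero hM hM1]

theorem exists_smul_one_add_posSemidef {H : Matrix n n ℂ} (hH : H.IsHermitian) :
    ∃ b : ℝ, 0 ≤ b ∧ (b • (1 : Matrix n n ℂ) + H).PosSemidef := by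
  set b : ℝ := ∑ i, |hH.eigenvalues i| with hb
  refine ⟨b, Finset.sum_nonneg fun i _ => abs_nonneg _, ?_⟩
  have h1 : (Matrix.diagonal fun i => ((b + hH.eigenvalues i : ℝ) : ℂ)).PosSemidef := by
    refine Matrix.posSemidef_diagonal_iff.mpr fun i => ?_
    have h2 : |hH.eigenvalues i| ≤ b :=
      Finset.single_le_sum (f := fun i => |hH.eigenvalues i|) (fun i _ => abs_nonneg _)
        (Finset.mem_univ i)
    rw [Complex.zero_le_real]
    linarith [neg_abs_le (hH.eigenvalues i)]
  have h3 := h1.mul_mul_conjTranspose_same (hH.eigenvectorUnitary : Matrix n n ℂ)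
  convert h3 using 1
  have h4 : (Matrix.diagonal fun i => ((b + hH.eigenvalues i : ℝ) : ℂ)) =
      (b : ℂ) • 1 + Matrix.diagonal fun i => (hH.eigenvalues i : ℂ) := by
    rw [Matrix.smul_one_eq_diagonal, Matrix.diagonal_add]
    simp
  rw [h4, Matrix.mul_add, Matrix.add_mul, ← spectral_decomp hH, Matrix.mul_smul, Matrix.mul_one,
    Matrix.smul_mul, eigenvectorUnitary_mul_conjTranspose, Complex.coe_smul]

theorem exists_isHermitian_re_trace_eq (h : Matrix n n ℂ →ₗ[ℝ] ℝ) :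
    ∃ ω : Matrix n n ℂ, ω.IsHermitian ∧
      ∀ X : Matrix n n ℂ, X.IsHermitian → h X = ((ω * X).trace).re := by
  set Ω : Matrix n n ℂ := Matrix.of fun j i =>
    (h (Matrix.single i j 1) : ℂ) - (h (Matrix.single i j Complex.I) : ℂ) * Complex.I with hΩ
  have key : ∀ X : Matrix n n ℂ, h X = ((Ω * X).trace).re := by
    intro X
    have hs : ∀ i j, h (Matrix.single i j (X i j)) = (Ω j i * X i j).re := by
      intro i j
      have : Matrix.single i j (X i j) = (X i j).re • Matrix.single i j (1 : ℂ) +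
          (X i j).im • Matrix.single i j Complex.I := by
        rw [Matrix.smul_single, Matrix.smul_single, ← Matrix.single_add]
        congr 1
        simp [Complex.re_add_im]
      rw [this, map_add, map_smul, map_smul]
      simp [hΩ]
      ring
    conv_lhs => rw [Matrix.matrix_eq_sum_single X]
    simp only [map_sum, hs, Matrix.trace, Matrix.diag_apply, Matrix.mul_apply, Complex.re_sum]
    exact Finset.sum_comm
  refine ⟨(2⁻¹ : ℝ) • (Ω + Ωᴴ), ?_, fun X hX => ?_⟩
  · rw [Matrix.IsHermitian, Matrix.conjTranspose_smul, Matrix.conjTranspose_add,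
      Matrix.conjTranspose_conjTranspose, add_comm]
    simp
  · have h1 : ((Ωᴴ * X).trace).re = ((Ω * X).trace).re := by
      have : (Ωᴴ * X).trace = star ((Ω * X).trace) := by
        rw [← Matrix.trace_conjTranspose, Matrix.conjTranspose_mul, hX.eq, Matrix.trace_mul_comm]
      rw [this, Complex.star_def, Complex.conj_re]
    rw [key, Matrix.smul_mul, Matrix.trace_smul, Matrix.add_mul, Matrix.trace_add,
      Complex.smul_re, Complex.add_re, h1, smul_eq_mul]
    ring

end Duality

section DualityPPT

variable {α β : Type*}

theorem ptB_zero : ptB (0 : Matrix (α × β) (α × β) ℂ) = 0 := rfl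

theorem ptB_smul (c : ℝ) (X : Matrix (α × β) (α × β) ℂ) : ptB (c • X) = c • ptB X := rfl

theorem ptB_one [DecidableEq α] [DecidableEq β] : ptB (1 : Matrix (α × β) (α × β) ℂ) = 1 := by
  ext p q
  simp only [ptB, Matrix.of_apply, Matrix.one_apply, Prod.ext_iff]
  refine if_congr ?_ rfl rfl
  rw [eq_comm (a := p.2)]

variable [Fintype α] [Fintype β] [DecidableEq α] [DecidableEq β]

/-- Perturbations `y` of the constraints of the dual program for which the value `c` is reached. -/
def DualFeasible (k : ℕ) (ρ : Matrix (α × β) (α × β) ℂ) (c : ℝ)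
    (y : ℝ × (ℕ → Matrix (α × β) (α × β) ℂ)) : Prop :=
  ∃ (W : Matrix (α × β) (α × β) ℂ) (l r s : ℝ) (D : ℕ → Matrix (α × β) (α × β) ℂ),
    IsWeightedTest ρ W l r ∧ 0 ≤ s ∧ l * c - (r + l - s) ≤ y.1 ∧
    (ptB (D 1) - W + (y.2 1 + (y.2 1)ᴴ)).PosSemidef ∧
    (∀ i ∈ Finset.Icc 1 (k - 1),
      (ptB (D (i + 1)) + (y.2 (i + 1) + (y.2 (i + 1))ᴴ) - D i).PosSemidef ∧
      (ptB (D (i + 1)) + (y.2 (i + 1) + (y.2 (i + 1))ᴴ) + D i).PosSemidef) ∧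
    (s • (1 : Matrix (α × β) (α × β) ℂ) - D k).PosSemidef ∧
    (s • (1 : Matrix (α × β) (α × β) ℂ) + D k).PosSemidef

/-- The pointed cone of perturbations for which the dual program is feasible. -/
def dualCone (k : ℕ) (ρ : Matrix (α × β) (α × β) ℂ) (c : ℝ) :
    PointedCone ℝ (ℝ × (ℕ → Matrix (α × β) (α × β) ℂ)) where
  carrier := {y | DualFeasible k ρ c y}
  zero_mem' := by
    refine ⟨0, 0, 0, 0, 0, .zero ρ, le_rfl, by simp, ?_, fun i _ => ⟨?_, ?_⟩, ?_, ?_⟩ <;>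
      simpa [ptB_zero] using Matrix.PosSemidef.zero
  add_mem' := by
    rintro y y' ⟨W, l, r, s, D, hW, hs, hy, h1, h2, h3, h4⟩
      ⟨W', l', r', s', D', hW', hs', hy', h1', h2', h3', h4'⟩
    refine ⟨W + W', l + l', r + r', s + s', D + D', hW.add hW', add_nonneg hs hs', ?_, ?_,
      fun i hi => ⟨?_, ?_⟩, ?_, ?_⟩
    · rw [Prod.fst_add]
      linarith
    · convert h1.add h1' using 1
      simp only [Pi.add_apply, Prod.snd_add, ptB_add, Matrix.conjTranspose_add]
      abel
    · convert (h2 i hi).1.add (h2' i hi).1 using 1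
      simp only [Pi.add_apply, Prod.snd_add, ptB_add, Matrix.conjTranspose_add]
      abel
    · convert (h2 i hi).2.add (h2' i hi).2 using 1
      simp only [Pi.add_apply, Prod.snd_add, ptB_add, Matrix.conjTranspose_add]
      abel
    · convert h3.add h3' using 1
      simp only [Pi.add_apply, add_smul]
      abel
    · convert h4.add h4' using 1
      simp only [Pi.add_apply, add_smul]
      abel
  smul_mem' := by
    rintro ⟨a, ha⟩ y ⟨W, l, r, s, D, hW, hs, hy, h1, h2, h3, h4⟩
    have hay : (⟨a, ha⟩ : {a : ℝ // 0 ≤ a}) • y = a • y := rfl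
    refine ⟨a • W, a * l, a * r, a * s, a • D, hW.smul ha, mul_nonneg ha hs, ?_, ?_,
      fun i hi => ⟨?_, ?_⟩, ?_, ?_⟩
    · rw [hay, Prod.smul_fst, smul_eq_mul]
      have := mul_le_mul_of_nonneg_left hy ha
      linarith
    · convert h1.smul ha using 1
      simp only [hay, Pi.smul_apply, Prod.smul_snd, ptB_smul, Matrix.conjTranspose_smul,
        star_trivial, smul_add, smul_sub]
    · convert (h2 i hi).1.smul ha using 1
      simp only [hay, Pi.smul_apply, Prod.smul_snd, ptB_smul, Matrix.conjTranspose_smul,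
        star_trivial, smul_add, smul_sub]
    · convert (h2 i hi).2.smul ha using 1
      simp only [hay, Pi.smul_apply, Prod.smul_snd, ptB_smul, Matrix.conjTranspose_smul,
        star_trivial, smul_add]
    · convert h3.smul ha using 1
      simp only [Pi.smul_apply, smul_sub, smul_smul]
    · convert h4.smul ha using 1
      simp only [Pi.smul_apply, smul_add, smul_smul]

theorem exists_add_mem_dualCone (k : ℕ) (ρ : Matrix (α × β) (α × β) ℂ) (c : ℝ)
    (y : ℝ × (ℕ → Matrix (α × β) (α × β) ℂ)) : ∃ t : ℝ, ((t, 0) + y) ∈ dualCone k ρ c := by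
  choose b hb0 hb using fun i =>
    exists_smul_one_add_posSemidef (Matrix.isHermitian_add_transpose_self (y.2 i))
  set d : ℕ → ℝ := fun j => ∑ i ∈ Finset.range (j + 1), b i with hd
  have hd0 : ∀ j, 0 ≤ d j := fun j => Finset.sum_nonneg fun i _ => hb0 i
  have hds : ∀ j, d (j + 1) = d j + b (j + 1) := fun j => Finset.sum_range_succ b (j + 1)
  have h1 : ∀ a : ℝ, 0 ≤ a → (a • (1 : Matrix (α × β) (α × β) ℂ)).PosSemidef :=
    fun a ha => Matrix.PosSemidef.one.smul ha
  refine ⟨d k - y.1, 0, 0, 0, d k, fun j => d j • 1, .zero ρ, hd0 k, by simp, ?_,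
    fun i _ => ⟨?_, ?_⟩, ?_, ?_⟩
  · convert (h1 _ (hd0 0)).add (hb 1) using 1
    simp only [ptB_add, ptB_smul, ptB_one, Prod.snd_add, Pi.add_apply, Pi.zero_apply, zero_add,
      hds 0, add_smul]
    abel
  · convert hb (i + 1) using 1
    simp only [ptB_add, ptB_smul, ptB_one, Prod.snd_add, Pi.add_apply, Pi.zero_apply, zero_add, hds i,
      add_smul]
    abel
  · convert ((h1 _ (hd0 i)).add (h1 _ (hd0 i))).add (hb (i + 1)) using 1
    simp only [ptB_add, ptB_smul, ptB_one, Prod.snd_add, Pi.add_apply, Pi.zero_apply, zero_add, hds i,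
      add_smul]
    abel
  · simpa using Matrix.PosSemidef.zero
  · exact (h1 _ (hd0 k)).add (h1 _ (hd0 k))

/-- A negative perturbation of the objective yields a dual certificate. -/
theorem exists_isDualCert_of_mem_dualCone {k : ℕ} {ρ : Matrix (α × β) (α × β) ℂ} {c t : ℝ}
    (ht : t < 0) (hmem : ((t, 0) : ℝ × (ℕ → Matrix (α × β) (α × β) ℂ)) ∈ dualCone k ρ c) :
    ∃ (m : ℕ) (M : Fin m → Matrix (α × β) (α × β) ℂ) (w : Fin m → ℝ)
      (D : ℕ → Matrix (α × β) (α × β) ℂ) (s : ℝ), IsPOVM M ∧ (∀ x, 0 < w x) ∧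
      IsDualCert k (∑ x, (w x : ℂ) • M x) D s ∧
      c < ∑ x, ((M x * ρ).trace).re * Real.log (w x) - Real.log s := by
  obtain ⟨W, l, r, s, D, hW, hs, hy, h1, h2, h3, h4⟩ := hmem
  have hl : 0 < l := by
    refine lt_of_le_of_ne hW.1 fun h0 => ?_
    subst h0
    have := hW.eq_zero
    simp only at hy
    linarith
  have hli : 0 ≤ l⁻¹ := inv_nonneg.mpr hl.le
  obtain ⟨-, m, M, w, hM, hw, hM1, hWM, hr⟩ := hW.smul hli
  rw [inv_mul_cancel₀ hl.ne', one_smul] at hM1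
  set δ : ℝ := -(l⁻¹ * t) / 2 with hδ
  have hδ0 : 0 < δ := by
    have := mul_neg_of_pos_of_neg (inv_pos.mpr hl) ht
    linarith
  have hδ1 : (δ • (1 : Matrix (α × β) (α × β) ℂ)).PosSemidef := Matrix.PosSemidef.one.smul hδ0.le
  have hs' : 0 < l⁻¹ * s + δ := by positivity
  refine ⟨m, M, w, l⁻¹ • D, l⁻¹ * s + δ, ⟨hM, hM1⟩, hw,
    ⟨hs', ?_, ?_, fun i hi => ⟨?_, ?_⟩, ?_, ?_⟩, ?_⟩
  · exact Matrix.posSemidef_sum _ fun x _ => (hM x).smul (Complex.zero_le_real.mpr (hw x).le)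
  · rw [← hWM]
    convert h1.smul hli using 1
    simp [ptB_smul, smul_sub]
  · convert (h2 i hi).1.smul hli using 1
    simp [ptB_smul, smul_sub]
  · convert (h2 i hi).2.smul hli using 1
    simp [ptB_smul]
  · convert (h3.smul hli).add hδ1 using 1
    rw [Complex.coe_smul, add_smul, smul_sub, smul_smul, Pi.smul_apply]
    abel
  · convert (h4.smul hli).add hδ1 using 1
    rw [Complex.coe_smul, add_smul, smul_add, smul_smul, Pi.smul_apply]
    abel
  · rw [← hr]
    have hlog := Real.log_le_sub_one_of_pos hs'
    have hc := mul_le_mul_of_nonneg_left hy hli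
    have hcl : l⁻¹ * (l * c - (r + l - s)) = c - (l⁻¹ * r + 1 - l⁻¹ * s) := by
      field_simp
    rw [hcl] at hc
    linarith

end DualityPPT

section DualityPPTPrimal

variable {α β : Type*} [Fintype α] [Fintype β] [DecidableEq α] [DecidableEq β]

/-- If the dual program cannot improve on `c`, some element of `PPT_k` attains `c` for all tests. -/
theorem exists_memPPTk_of_forall_nonneg {k : ℕ} (hk : 1 ≤ k) {ρ : Matrix (α × β) (α × β) ℂ}
    {c : ℝ}
    (hnn : ∀ t : ℝ, ((t, 0) : ℝ × (ℕ → Matrix (α × β) (α × β) ℂ)) ∈ dualCone k ρ c → 0 ≤ t) :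
    ∃ σ : Matrix (α × β) (α × β) ℂ, memPPTk k σ ∧
      ∀ (m : ℕ) (M : Fin m → Matrix (α × β) (α × β) ℂ) (w : Fin m → ℝ), IsPOVM M →
        (∀ x, 0 < w x) →
        ∑ x, ((M x * ρ).trace).re * Real.log (w x) + 1 - ∑ x, ((M x * σ).trace).re * w x ≤ c := by
  obtain ⟨g, hg, hgK⟩ := riesz_extension (dualCone k ρ c)
    { domain := (LinearMap.snd ℝ ℝ (ℕ → Matrix (α × β) (α × β) ℂ)).ker
      toFun := (LinearMap.fst ℝ ℝ (ℕ → Matrix (α × β) (α × β) ℂ)).comp (Submodule.subtype _) }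
    (by
      rintro ⟨⟨t, Y⟩, hY⟩ hmem
      obtain rfl : Y = 0 := hY
      exact hnn t hmem)
    (fun y => by
      obtain ⟨t, ht⟩ := exists_add_mem_dualCone k ρ c y
      exact ⟨⟨(t, 0), rfl⟩, ht⟩)
  have hg0 : ∀ t : ℝ, g (t, 0) = t := fun t => hg ⟨(t, 0), rfl⟩
  have hrep := fun i : ℕ => exists_isHermitian_re_trace_eq
    ((g.comp (LinearMap.inr ℝ ℝ (ℕ → Matrix (α × β) (α × β) ℂ))).comp
      ((2⁻¹ : ℝ) • LinearMap.single ℝ (fun _ : ℕ => Matrix (α × β) (α × β) ℂ) i))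
  choose ω hωh hω using hrep
  have hgs : ∀ (i : ℕ) (X : Matrix (α × β) (α × β) ℂ), X.IsHermitian →
      g (0, Pi.single i ((2⁻¹ : ℝ) • X)) = ((ω i * X).trace).re := by
    intro i X hX
    rw [← hω i X hX]
    simp [← Pi.single_smul]
  have hhalf : ∀ X : Matrix (α × β) (α × β) ℂ, X.IsHermitian →
      (2⁻¹ : ℝ) • X + (2⁻¹ : ℝ) • Xᴴ = X := by
    intro X hX
    rw [hX.eq]
    module
  have hhalf' : ∀ X : Matrix (α × β) (α × β) ℂ, X.IsHermitian →
      X + (-((2⁻¹ : ℝ) • X) + -((2⁻¹ : ℝ) • Xᴴ)) = 0 := by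
    intro X hX
    rw [hX.eq]
    module
  have hz : (0 : Matrix (α × β) (α × β) ℂ).PosSemidef := Matrix.PosSemidef.zero
  -- Perturbing only the first constraint.
  have hfirst : ∀ (W X : Matrix (α × β) (α × β) ℂ) (l r : ℝ), IsWeightedTest ρ W l r →
      X.IsHermitian → (X - W).PosSemidef → 0 ≤ l * c - (r + l) + ((ω 1 * X).trace).re := by
    intro W X l r hW hX hXW
    have hmem : (l * c - (r + l), Pi.single 1 ((2⁻¹ : ℝ) • X)) ∈ dualCone k ρ c := by
      refine ⟨W, l, r, 0, 0, hW, le_rfl, by simp, ?_, fun i hi => ?_, ?_, ?_⟩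
      · simpa [ptB_zero, hhalf X hX, sub_eq_neg_add] using hXW
      · have hi1 : i ≠ 0 := by have := Finset.mem_Icc.mp hi; omega
        simpa [ptB_zero, hi1] using hz
      · simpa using hz
      · simpa using hz
    have := hgK _ hmem
    rw [← zero_add (Pi.single 1 _), ← add_zero (l * c - (r + l)), ← Prod.mk_add_mk, map_add, hg0,
      hgs 1 X hX] at this
    exact this
  have hstep : ∀ i ∈ Finset.Icc 1 (k - 1), ∀ X Z : Matrix (α × β) (α × β) ℂ, X.IsHermitian →
      Z.IsHermitian → (X - Z).PosSemidef → (X + Z).PosSemidef →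
      0 ≤ ((ω (i + 1) * X).trace).re - ((ω i * ptB Z).trace).re := by
    intro i hi X Z hX hZ h1 h2
    obtain ⟨hi1, hik⟩ := Finset.mem_Icc.mp hi
    have hmem : ((0 : ℝ), (Pi.single (i + 1) ((2⁻¹ : ℝ) • X) -
        Pi.single i ((2⁻¹ : ℝ) • ptB Z) : ℕ → Matrix (α × β) (α × β) ℂ)) ∈ dualCone k ρ c := by
      refine ⟨0, 0, 0, 0, Pi.single i Z, .zero ρ, le_rfl, by simp, ?_, fun j hj => ?_, ?_, ?_⟩
      · by_cases hi : i = 1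
        · subst hi
          simpa [hhalf' _ (ptB_isHermitian hZ)] using hz
        · have h0 : 1 ≠ i + 1 := by omega
          simpa [ptB_zero, Ne.symm hi, Pi.single_eq_of_ne h0] using hz
      · have hj0 : j ≠ j + 1 := by omega
        by_cases hji : j = i
        · subst hji
          simpa [hj0.symm, hj0, ptB_zero, hhalf X hX] using And.intro h1 h2
        by_cases hji' : j + 1 = i
        · subst hji'
          have h0 : j ≠ j + 1 + 1 := by omega
          simpa [hj0, h0, hhalf' _ (ptB_isHermitian hZ)] using hz
        · simpa [hji, hji', ptB_zero] using hz
      · have : k ≠ i := by omega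
        simpa [this] using hz
      · have : k ≠ i := by omega
        simpa [this] using hz
    have := hgK _ hmem
    rwa [← sub_self (0 : ℝ), ← Prod.mk_sub_mk, map_sub, hgs _ X hX,
      hgs _ _ (ptB_isHermitian hZ), sub_self] at this
  have hlast : ∀ Z : Matrix (α × β) (α × β) ℂ, Z.IsHermitian → (1 - Z).PosSemidef →
      (1 + Z).PosSemidef → ((ω k * ptB Z).trace).re ≤ 1 := by
    intro Z hZ h1 h2
    have hmem : ((1 : ℝ), (- Pi.single k ((2⁻¹ : ℝ) • ptB Z) :
        ℕ → Matrix (α × β) (α × β) ℂ)) ∈ dualCone k ρ c := by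
      refine ⟨0, 0, 0, 1, Pi.single k Z, .zero ρ, zero_le_one, by simp, ?_, fun j hj => ?_, ?_, ?_⟩
      · by_cases hk1 : k = 1
        · subst hk1
          simpa [hhalf' _ (ptB_isHermitian hZ)] using hz
        · simpa [ptB_zero, Ne.symm hk1] using hz
      · have := Finset.mem_Icc.mp hj
        have hjk : j ≠ k := by omega
        by_cases hjk' : j + 1 = k
        · subst hjk'
          simpa [hhalf' _ (ptB_isHermitian hZ)] using hz
        · simpa [hjk, hjk', ptB_zero] using hz
      · simpa using h1
      · simpa using h2
    have := hgK _ hmem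
    rw [← zero_sub (Pi.single k _), ← sub_zero (1 : ℝ), ← Prod.mk_sub_mk, map_sub, hg0,
      hgs _ _ (ptB_isHermitian hZ)] at this
    linarith
  have hpos : (ω 1).PosSemidef := by
    refine posSemidef_of_re_trace_mul_nonneg (hωh 1) fun X hX => ?_
    simpa using hfirst 0 X 0 0 (.zero ρ) hX.1 (by simpa using hX)
  refine ⟨ω 1, ⟨hpos, ω, rfl, fun i _ => hωh i, fun i hi => ⟨?_, ?_⟩, ?_⟩, ?_⟩
  · refine posSemidef_of_re_trace_mul_nonneg ((hωh _).sub (ptB_isHermitian (hωh i))) fun X hX => ?_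
    have := hstep i hi X X hX.1 hX.1 (by simpa using hz) (hX.add hX)
    rwa [Matrix.sub_mul, Matrix.trace_sub, Complex.sub_re, trace_ptB_mul]
  · refine posSemidef_of_re_trace_mul_nonneg ((hωh _).add (ptB_isHermitian (hωh i))) fun X hX => ?_
    have := hstep i hi X (-X) hX.1 hX.1.neg (by simpa using hX.add hX) (by simpa using hz)
    rw [← trace_ptB_mul, Matrix.mul_neg, Matrix.trace_neg, Complex.neg_re] at this
    rw [Matrix.add_mul, Matrix.trace_add, Complex.add_re]
    linarith
  · obtain ⟨Z, h1, h2, hZ⟩ := exists_contraction_trace_eq_traceNorm (ptB_isHermitian (hωh k))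
    have hZh : Z.IsHermitian := by simpa using h2.1.sub Matrix.isHermitian_one
    rw [← hZ, trace_ptB_mul]
    exact hlast Z hZh h1 h2
  · intro m M w hM hw
    have hW : (∑ x, (w x : ℂ) • M x).PosSemidef :=
      Matrix.posSemidef_sum _ fun x _ => (hM.1 x).smul (Complex.zero_le_real.mpr (hw x).le)
    have := hfirst _ _ 1 _ ⟨zero_le_one, m, M, w, hM.1, hw, by rw [one_smul, hM.2], rfl, rfl⟩ hW.1
      (by simpa using hz)
    have hq : ((ω 1 * ∑ x, (w x : ℂ) • M x).trace).re = ∑ x, ((M x * ω 1).trace).re * w x := by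
      rw [Matrix.trace_mul_comm, Finset.sum_mul, Matrix.trace_sum, Complex.re_sum]
      refine Finset.sum_congr rfl fun x _ => ?_
      rw [Matrix.smul_mul, Matrix.trace_smul, smul_eq_mul, Complex.re_ofReal_mul, mul_comm]
    rw [hq] at this
    linarith

end DualityPPTPrimal

theorem sum_klTerm_le {m : ℕ} {p q : Fin m → ℝ} (hp : ∀ x, 0 ≤ p x) (hq : ∀ x, 0 ≤ q x)
    (hp1 : ∑ x, p x = 1) {c : ℝ}
    (h : ∀ w : Fin m → ℝ, (∀ x, 0 < w x) →
      ∑ x, p x * Real.log (w x) + 1 - ∑ x, q x * w x ≤ c * Real.log 2) :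
    ∑ x, klTerm (p x) (q x) ≤ (c : EReal) := by
  have hac : ∀ x, p x ≠ 0 → q x ≠ 0 := by
    intro x hpx hqx
    set T : ℝ := (c * Real.log 2 + ∑ y, q y) / p x with hT
    have h1 := h (fun y => if y = x then Real.exp T else 1) fun y => by split_ifs <;> positivity
    have h2 : ∑ y, p y * Real.log (if y = x then Real.exp T else 1) = p x * T := by
      rw [Finset.sum_eq_single x (fun y _ hy => by simp [hy]) (by simp)]
      simp
    have h3 : ∑ y, q y * (if y = x then Real.exp T else 1) = ∑ y, q y := by
      refine Finset.sum_congr rfl fun y _ => ?_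
      split_ifs with hy
      · rw [hy, hqx, zero_mul]
      · rw [mul_one]
    rw [h2, h3, hT, mul_div_cancel₀ _ hpx] at h1
    linarith
  have hkl : ∀ x, klTerm (p x) (q x) = ((p x * Real.logb 2 (p x / q x) : ℝ) : EReal) := by
    intro x
    unfold klTerm
    split_ifs with h1 h2
    · simp [h1]
    · exact absurd h2 (hac x h1)
    · rfl
  have hsum : ∑ x, p x * Real.log (p x / q x) ≤ c * Real.log 2 := by
    refine le_of_forall_pos_le_add fun δ hδ => ?_
    have hQ : 0 ≤ ∑ x, q x := Finset.sum_nonneg fun x _ => hq x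
    set ε : ℝ := δ / (∑ x, q x + 1) with hε
    have hε0 : 0 < ε := by positivity
    have h1 := h (fun x => if p x = 0 then ε else p x / q x) fun x => by
      split_ifs with hx
      · exact hε0
      · exact div_pos (lt_of_le_of_ne (hp x) (Ne.symm hx))
          (lt_of_le_of_ne (hq x) (Ne.symm (hac x hx)))
    have h2 : ∑ x, p x * Real.log (if p x = 0 then ε else p x / q x) =
        ∑ x, p x * Real.log (p x / q x) := by
      refine Finset.sum_congr rfl fun x _ => ?_
      split_ifs with hx
      · simp [hx]
      · rfl
    have h3 : ∑ x, q x * (if p x = 0 then ε else p x / q x) ≤ 1 + δ := by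
      calc ∑ x, q x * (if p x = 0 then ε else p x / q x) ≤ ∑ x, (p x + ε * q x) := by
            refine Finset.sum_le_sum fun x _ => ?_
            split_ifs with hx
            · rw [hx]; linarith
            · rw [mul_div_cancel₀ _ (hac x hx)]
              linarith [mul_nonneg hε0.le (hq x)]
        _ = 1 + ε * ∑ x, q x := by rw [Finset.sum_add_distrib, hp1, Finset.mul_sum]
        _ ≤ 1 + ε * (∑ x, q x + 1) := by linarith
        _ = 1 + δ := by rw [hε, div_mul_cancel₀ _ (by positivity)]
    rw [h2] at h1
    linarith
  have hcoe : ∑ x, klTerm (p x) (q x) =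
      ((∑ x, p x * Real.logb 2 (p x / q x) : ℝ) : EReal) := by
    rw [Finset.sum_congr rfl fun x _ => hkl x]
    exact (map_sum (⟨⟨Real.toEReal, EReal.coe_zero⟩, EReal.coe_add⟩ : ℝ →+ EReal) _ _).symm
  rw [hcoe, EReal.coe_le_coe_iff]
  have hlog2 : 0 < Real.log 2 := Real.log_pos one_lt_two
  have : ∑ x, p x * Real.logb 2 (p x / q x) = (∑ x, p x * Real.log (p x / q x)) / Real.log 2 := by
    rw [Finset.sum_div]
    exact Finset.sum_congr rfl fun x _ => mul_div_assoc' _ _ _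
  rwa [this, div_le_iff₀ hlog2]

theorem measRelEnt_le {ρ σ : Matrix n n ℂ} (hρ : ρ.PosSemidef) (hρ1 : ρ.trace = 1)
    (hσ : σ.PosSemidef) {c : ℝ}
    (h : ∀ (m : ℕ) (M : Fin m → Matrix n n ℂ) (w : Fin m → ℝ), IsPOVM M → (∀ x, 0 < w x) →
      ∑ x, ((M x * ρ).trace).re * Real.log (w x) + 1 - ∑ x, ((M x * σ).trace).re * w x ≤
        c * Real.log 2) :
    measRelEnt ρ σ ≤ (c : EReal) := by
  refine iSup_le fun m => iSup_le fun M => iSup_le fun hM => ?_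
  refine sum_klTerm_le (fun x => re_trace_mul_nonneg (hM.1 x) hρ)
    (fun x => re_trace_mul_nonneg (hM.1 x) hσ) ?_ fun w hw => h m M w hM hw
  rw [← Complex.re_sum, ← Matrix.trace_sum, ← Finset.sum_mul, hM.2, Matrix.one_mul, hρ1,
    Complex.one_re]

/-- superadditivity,
`D(ρ^{⊗n} ‖ PPT_k(Aⁿ:Bⁿ)) ≥ n · D_M(ρ ‖ PPT_k(A:B))`. -/
theorem relEnt_pptk_superadditive {dA dB : ℕ} (k : ℕ) (hk : 2 ≤ k)
    (ρ : Matrix (Fin dA × Fin dB) (Fin dA × Fin dB) ℂ)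
    (hρ : ρ.PosSemidef) (hρ1 : ρ.trace = 1) (n : ℕ) (hn : 1 ≤ n) :
    (n : EReal) *
        (⨅ (σ : Matrix (Fin dA × Fin dB) (Fin dA × Fin dB) ℂ) (_ : memPPTk k σ),
          measRelEnt ρ σ) ≤
      ⨅ (τ : Matrix ((Fin n → Fin dA) × (Fin n → Fin dB))
            ((Fin n → Fin dA) × (Fin n → Fin dB)) ℂ) (_ : memPPTk k τ),
        relEnt (kronPowBip n ρ) τ := by
  refine le_iInf fun τ => le_iInf fun hτ => ?_
  by_cases hsupp : suppLE (kronPowBip n ρ) τ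
  swap
  · rw [relEnt, if_neg hsupp]
    exact le_top
  rw [relEnt, if_pos hsupp]
  set d : ℝ := ((kronPowBip n ρ * (matLog (kronPowBip n ρ) - matLog τ)).trace).re with hd
  set I : EReal := ⨅ (σ : Matrix (Fin dA × Fin dB) (Fin dA × Fin dB) ℂ) (_ : memPPTk k σ),
    measRelEnt ρ σ with hI
  have hn0 : (0 : ℝ) < n := Nat.cast_pos.mpr hn
  have hlog2 : 0 < Real.log 2 := Real.log_pos one_lt_two
  have key : I ≤ ((d / n : ℝ) : EReal) := by
    by_contra! hlt
    obtain ⟨c, hdc, hcI⟩ := EReal.lt_iff_exists_real_btwn.mp hlt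
    rw [EReal.coe_lt_coe_iff, div_lt_iff₀ hn0] at hdc
    have hneg : ∃ t : ℝ, t < 0 ∧
        ((t, 0) : ℝ × (ℕ → Matrix (Fin dA × Fin dB) (Fin dA × Fin dB) ℂ)) ∈
          dualCone k ρ (c * Real.log 2) := by
      by_contra! hnn
      obtain ⟨σ, hσ, hσM⟩ := exists_memPPTk_of_forall_nonneg (by omega : 1 ≤ k) (ρ := ρ)
        (c := c * Real.log 2) fun t ht => not_lt.mp fun ht0 => hnn t ht0 ht
      exact absurd ((iInf₂_le σ hσ).trans (measRelEnt_le hρ hρ1 hσ.1 hσM)) (not_le.mpr hcI)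
    obtain ⟨t, ht, hmem⟩ := hneg
    obtain ⟨m, M, w, D, s, hM, hw, hcert, hc⟩ := exists_isDualCert_of_mem_dualCone ht hmem
    have h1 := hcert.mul_le_relEnt (by omega : 1 ≤ k) hρ hρ1 hM.1 hM.2 hw n hτ hsupp
    have h2 := mul_le_mul_of_nonneg_left hc.le hn0.le
    have h3 : Real.log 2 * (c * n) ≤ Real.log 2 * d := by linarith
    exact absurd (le_of_mul_le_mul_left h3 hlog2) (not_le.mpr hdc)
  calc (n : EReal) * I ≤ (n : EReal) * ((d / n : ℝ) : EReal) := by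
        gcongr
    _ = ((n * (d / n) : ℝ) : EReal) := by
        rw [EReal.coe_mul]; rfl
    _ = (d : EReal) := by rw [mul_div_cancel₀ _ hn0.ne']

end QIT
end
end

section
/- Let ω be a positive semidefinite matrix on ℂ^{dA} ⊗ ℂ^{dB}. Then the support function of the Rains set satisfies the duality: sup{ tr[ω σ] : σ positive semidefinite, ‖σ^{T_B}‖₁ ≤ 1 } = inf{ ‖γ^{T_B}‖_∞ : γ Hermitian, γ ≥ ω }. -/
open scoped Kronecker ComplexOrder Matrix

attribute [local instance] Classical.propDecidable

noncomputable section

namespace QIT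

variable {n : Type*} [Fintype n] [DecidableEq n]

section Norms

open scoped Matrix.Norms.L2Operator InnerProductSpace

lemma conjTranspose_mul_self_spectral (A : Matrix n n ℂ) :
    Aᴴ * A =
      ((Matrix.posSemidef_conjTranspose_mul_self A).1.eigenvectorUnitary : Matrix n n ℂ) *
        Matrix.diagonal (fun i =>
          (((Matrix.posSemidef_conjTranspose_mul_self A).1.eigenvalues i : ℝ) : ℂ)) *
        ((Matrix.posSemidef_conjTranspose_mul_self A).1.eigenvectorUnitary : Matrix n n ℂ)ᴴ := by
  have h := (Matrix.posSemidef_conjTranspose_mul_self A).1.spectral_theorem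
  rw [Unitary.conjStarAlgAut_apply] at h
  exact h

lemma norm_unitary_conj (U : Matrix.unitaryGroup n ℂ) (D : Matrix n n ℂ) :
    ‖(U : Matrix n n ℂ) * D * (U : Matrix n n ℂ)ᴴ‖ = ‖D‖ := by
  have : CStarRing (Matrix n n ℂ) := Matrix.instCStarRing
  rw [← Matrix.star_eq_conjTranspose]
  have h := CStarRing.norm_mul_coe_unitary ((U : Matrix n n ℂ) * D) (star U)
  rw [Unitary.coe_star] at h
  rw [h, CStarRing.norm_coe_unitary_mul]

lemma opNorm_eq_norm (A : Matrix n n ℂ) : opNorm A = ‖A‖ := by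
  set hA := (Matrix.posSemidef_conjTranspose_mul_self A).1
  have hpos : ∀ i, 0 ≤ hA.eigenvalues i :=
    (Matrix.posSemidef_conjTranspose_mul_self A).eigenvalues_nonneg
  have hsq : ‖A‖ * ‖A‖ = ‖fun i => ((hA.eigenvalues i : ℝ) : ℂ)‖ := by
    rw [← Matrix.l2_opNorm_conjTranspose_mul_self, ← Matrix.l2_opNorm_diagonal]
    exact (congrArg norm (conjTranspose_mul_self_spectral A)).trans (norm_unitary_conj _ _)
  have hnn : 0 ≤ opNorm A := Real.iSup_nonneg fun i => Real.sqrt_nonneg _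
  apply le_antisymm
  · refine Real.iSup_le (fun i => ?_) (norm_nonneg _)
    rw [Real.sqrt_le_left (norm_nonneg _), sq, hsq]
    refine le_trans ?_ (norm_le_pi_norm _ i)
    simpa using le_abs_self _
  · refine le_of_sq_le_sq ?_ hnn
    rw [sq, hsq, pi_norm_le_iff_of_nonneg (sq_nonneg _)]
    intro i
    have h : Real.sqrt (hA.eigenvalues i) ≤ opNorm A :=
      le_ciSup (f := fun i => Real.sqrt (hA.eigenvalues i)) (Set.finite_range _).bddAbove i
    rw [Complex.norm_real, Real.norm_of_nonneg (hpos i)]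
    exact (Real.sqrt_le_left hnn).1 h

lemma traceNorm_nonneg (A : Matrix n n ℂ) : 0 ≤ traceNorm A :=
  Finset.sum_nonneg fun _ _ => Real.sqrt_nonneg _

lemma norm_trace_mul_le (B A : Matrix n n ℂ) : ‖(B * A).trace‖ ≤ ‖B‖ * traceNorm A := by
  set hA := (Matrix.posSemidef_conjTranspose_mul_self A).1
  let T := Matrix.toEuclideanCLM (n := n) (𝕜 := ℂ)
  have htr : (B * A).trace =
      ∑ i, ⟪hA.eigenvectorBasis i, T B (T A (hA.eigenvectorBasis i))⟫_ℂ := by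
    have h := LinearMap.trace_eq_sum_inner (Matrix.toEuclideanLin (B * A)) hA.eigenvectorBasis
    rw [Matrix.toEuclideanLin_eq_toLin_orthonormal, Matrix.trace_toLin_eq] at h
    rw [h]
    refine Finset.sum_congr rfl fun i _ => ?_
    rw [← mul_apply_eq_comp, ← map_mul, ← Matrix.toEuclideanLin_eq_toLin_orthonormal]
    rfl
  have hcol : ∀ i, ‖T A (hA.eigenvectorBasis i)‖ = Real.sqrt (hA.eigenvalues i) := by
    intro i
    have hT : T (Aᴴ * A) (hA.eigenvectorBasis i) =
        ((hA.eigenvalues i : ℝ) : ℂ) • hA.eigenvectorBasis i := by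
      apply WithLp.ofLp_injective
      rw [Matrix.ofLp_toEuclideanCLM, hA.mulVec_eigenvectorBasis]
      simp
    rw [← Real.sqrt_sq (norm_nonneg (T A _)), ← inner_self_eq_norm_sq (𝕜 := ℂ),
      ← ContinuousLinearMap.adjoint_inner_right, ← ContinuousLinearMap.star_eq_adjoint,
      ← map_star, ← mul_apply_eq_comp, ← map_mul, Matrix.star_eq_conjTranspose, hT,
      inner_smul_right, inner_self_eq_norm_sq_to_K]
    simp
  rw [htr, traceNorm, Finset.mul_sum]
  refine (norm_sum_le _ _).trans (Finset.sum_le_sum fun i _ => ?_)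
  rw [← hcol i]
  refine (norm_inner_le_norm _ _).trans ?_
  rw [OrthonormalBasis.norm_eq_one, one_mul]
  exact (T B).le_opNorm _

lemma exists_trace_mul_eq_traceNorm (A : Matrix n n ℂ) :
    ∃ B : Matrix n n ℂ, ‖B‖ ≤ 1 ∧ (B * A).trace = traceNorm A := by
  set hA := (Matrix.posSemidef_conjTranspose_mul_self A).1
  have hpos : ∀ i, 0 ≤ hA.eigenvalues i :=
    (Matrix.posSemidef_conjTranspose_mul_self A).eigenvalues_nonneg
  set U := (hA.eigenvectorUnitary : Matrix n n ℂ) with hU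
  have hUU : Uᴴ * U = 1 := Unitary.coe_star_mul_self hA.eigenvectorUnitary
  let s : n → ℝ := fun i => Real.sqrt (hA.eigenvalues i)
  have hs : ∀ i, s i * s i = hA.eigenvalues i := fun i => Real.mul_self_sqrt (hpos i)
  let D : Matrix n n ℂ := Matrix.diagonal fun i => (((s i)⁻¹ : ℝ) : ℂ)
  have hAA : Aᴴ * A = U * Matrix.diagonal (fun i => ((s i * s i : ℝ) : ℂ)) * Uᴴ := by
    simp_rw [hs]
    exact conjTranspose_mul_self_spectral A
  have hDH : Dᴴ = D := by
    simp [D, Matrix.diagonal_conjTranspose, Pi.star_def]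
  refine ⟨U * D * Uᴴ * Aᴴ, ?_, ?_⟩
  · set B := U * D * Uᴴ * Aᴴ with hB
    have hBB : Bᴴᴴ * Bᴴ =
        U * Matrix.diagonal (fun i => (((s i)⁻¹ * (s i * s i) * (s i)⁻¹ : ℝ) : ℂ)) * Uᴴ := by
      calc Bᴴᴴ * Bᴴ = U * D * Uᴴ * (Aᴴ * A) * U * D * Uᴴ := by
            simp only [hB, Matrix.conjTranspose_mul, Matrix.conjTranspose_conjTranspose, hDH,
              Matrix.mul_assoc]
        _ = U * D * (Uᴴ * U) * Matrix.diagonal (fun i => ((s i * s i : ℝ) : ℂ)) *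
              (Uᴴ * U) * D * Uᴴ := by
            rw [hAA]; simp only [Matrix.mul_assoc]
        _ = _ := by
            rw [hUU, Matrix.mul_one, Matrix.mul_one, Matrix.mul_assoc U, Matrix.mul_assoc U]
            simp only [D, Matrix.diagonal_mul_diagonal, Complex.ofReal_mul]
    have hn : ‖B‖ * ‖B‖ ≤ 1 := by
      rw [← Matrix.l2_opNorm_conjTranspose, ← Matrix.l2_opNorm_conjTranspose_mul_self, hBB, hU,
        norm_unitary_conj, Matrix.l2_opNorm_diagonal, pi_norm_le_iff_of_nonneg zero_le_one]
      intro i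
      rw [Complex.norm_real]
      rcases eq_or_ne (s i) 0 with h | h
      · simp [h]
      · rw [inv_mul_cancel_left₀ h, mul_inv_cancel₀ h, norm_one]
    nlinarith [norm_nonneg B]
  · rw [Matrix.mul_assoc _ Aᴴ, hAA, ← Matrix.mul_assoc, ← Matrix.mul_assoc, Matrix.trace_mul_comm,
      Matrix.mul_assoc (U * D), hUU, Matrix.mul_one, ← Matrix.mul_assoc, ← Matrix.mul_assoc, hUU,
      Matrix.one_mul, Matrix.diagonal_mul_diagonal, Matrix.trace_diagonal, traceNorm,
      Complex.ofReal_sum]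
    refine Finset.sum_congr rfl fun i _ => ?_
    rw [← Complex.ofReal_mul]
    congr 1
    rcases eq_or_ne (s i) 0 with h | h
    · change _ = s i
      simp [h]
    · exact inv_mul_cancel_left₀ h _

lemma traceNorm_smul_le {c : ℝ} (hc : 0 ≤ c) (A : Matrix n n ℂ) :
    traceNorm ((c : ℂ) • A) ≤ c * traceNorm A := by
  obtain ⟨B, hB, htr⟩ := exists_trace_mul_eq_traceNorm ((c : ℂ) • A)
  have h := norm_trace_mul_le B A
  have h1 : traceNorm ((c : ℂ) • A) = c * ‖(B * A).trace‖ := by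
    have h2 := congrArg norm htr
    rw [Complex.norm_real, Real.norm_of_nonneg (traceNorm_nonneg _), Matrix.mul_smul,
      Matrix.trace_smul, norm_smul, Complex.norm_real, Real.norm_of_nonneg hc] at h2
    exact h2.symm
  rw [h1]
  refine mul_le_mul_of_nonneg_left (h.trans ?_) hc
  nlinarith [traceNorm_nonneg A]

end Norms

lemma ptB_ptB {α β : Type*} (X : Matrix (α × β) (α × β) ℂ) : ptB (ptB X) = X := rfl

lemma ptB_conjTranspose {α β : Type*} (X : Matrix (α × β) (α × β) ℂ) :
    ptB Xᴴ = (ptB X)ᴴ := rfl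

/-- The partial transpose as a real-linear map. -/
def ptBLinear (α β : Type*) : Matrix (α × β) (α × β) ℂ →ₗ[ℝ] Matrix (α × β) (α × β) ℂ where
  toFun := ptB
  map_add' _ _ := rfl
  map_smul' _ _ := rfl

lemma trace_ptB_mul_ptB {α β : Type*} [Fintype α] [Fintype β]
    (X Y : Matrix (α × β) (α × β) ℂ) : (ptB X * ptB Y).trace = (X * Y).trace := by
  simp only [Matrix.trace, Matrix.diag_apply, Matrix.mul_apply, Fintype.sum_prod_type, ptB,
    Matrix.of_apply]
  refine Finset.sum_congr rfl fun a _ => ?_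
  rw [Finset.sum_comm]
  conv_rhs => rw [Finset.sum_comm]
  refine Finset.sum_congr rfl fun a' _ => ?_
  rw [Finset.sum_comm]

open scoped MatrixOrder Matrix.Norms.L2Operator in
lemma re_trace_mul_nonneg_s12 {P Q : Matrix n n ℂ} (hP : P.PosSemidef) (hQ : Q.PosSemidef) :
    0 ≤ ((P * Q).trace).re := by
  obtain ⟨C, rfl⟩ := CStarAlgebra.nonneg_iff_eq_star_mul_self.1 hQ.nonneg
  rw [Matrix.star_eq_conjTranspose, ← Matrix.mul_assoc, Matrix.trace_mul_comm, ← Matrix.mul_assoc]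
  exact (Complex.nonneg_iff.1 (hP.mul_mul_conjTranspose_same C).trace_nonneg).1

lemma exists_re_trace_repr (f : Matrix n n ℂ →ₗ[ℝ] ℝ) :
    ∃ S : Matrix n n ℂ, ∀ X, f X = ((S * X).trace).re := by
  refine ⟨Matrix.of fun j i =>
    ⟨f (Matrix.single i j 1), -f (Matrix.single i j Complex.I)⟩, fun X => ?_⟩
  have hX : ∀ i j, f (Matrix.single i j (X i j)) =
      (X i j).re * f (Matrix.single i j 1) + (X i j).im * f (Matrix.single i j Complex.I) := by
    intro i j
    rw [← smul_eq_mul, ← smul_eq_mul, ← map_smul, ← map_smul, ← map_add, Matrix.smul_single,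
      Matrix.smul_single, ← Matrix.single_add]
    congr 2
    apply Complex.ext <;> simp
  conv_lhs => rw [Matrix.matrix_eq_sum_single X]
  simp only [map_sum, hX, Matrix.trace, Matrix.diag_apply, Matrix.mul_apply, Complex.re_sum,
    Matrix.of_apply, Complex.mul_re]
  rw [Finset.sum_comm]
  refine Finset.sum_congr rfl fun i _ => Finset.sum_congr rfl fun j _ => ?_
  ring

omit [DecidableEq n] in
lemma re_trace_conjTranspose_mul (S X : Matrix n n ℂ) :
    ((Sᴴ * X).trace).re = ((S * Xᴴ).trace).re := by
  rw [Matrix.trace_mul_comm S, ← Complex.conj_re, starRingEnd_apply, ← Matrix.trace_conjTranspose,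
    Matrix.conjTranspose_mul, Matrix.conjTranspose_conjTranspose]

section Duality

open scoped Matrix.Norms.L2Operator

variable {α β : Type*} [Fintype α] [Fintype β] [DecidableEq α] [DecidableEq β]

lemma re_trace_mul_le_opNorm_mul_traceNorm {ω γ σ : Matrix (α × β) (α × β) ℂ}
    (hγ : (γ - ω).PosSemidef) (hσ : σ.PosSemidef) :
    ((ω * σ).trace).re ≤ opNorm (ptB γ) * traceNorm (ptB σ) := by
  have h := re_trace_mul_nonneg_s12 hγ hσ
  rw [Matrix.sub_mul, Matrix.trace_sub, Complex.sub_re, sub_nonneg] at h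
  refine h.trans ?_
  rw [← trace_ptB_mul_ptB, opNorm_eq_norm]
  exact (Complex.re_le_norm _).trans (norm_trace_mul_le _ _)

/-- A real functional separating the matrices whose partial transpose has operator norm below `t`
from those dominating `ω` is represented by a positive semidefinite matrix. -/
lemma exists_posSemidef_separating {ω : Matrix (α × β) (α × β) ℂ} (hω : ω.IsHermitian) {t : ℝ}
    (ht : ∀ γ : Matrix (α × β) (α × β) ℂ, γ.IsHermitian → (γ - ω).PosSemidef →
      t ≤ opNorm (ptB γ)) :
    ∃ (σ : Matrix (α × β) (α × β) ℂ) (u : ℝ), σ.PosSemidef ∧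
      (∀ k, ‖ptB k‖ < t → ((σ * k).trace).re < u) ∧ u ≤ ((σ * ω).trace).re := by
  have hcont : Continuous (ptBLinear α β) := LinearMap.continuous_of_finiteDimensional _
  obtain ⟨f, u, hfK, hfC⟩ := geometric_hahn_banach_open
    (s := ptBLinear α β ⁻¹' Metric.ball 0 t)
    (t := {γ | γ.IsHermitian ∧ (γ - ω).PosSemidef})
    ((convex_ball _ _).linear_preimage _) (Metric.isOpen_ball.preimage hcont)
    (by
      rintro X ⟨hX, hX'⟩ Y ⟨hY, hY'⟩ a b ha hb hab
      refine ⟨(hX.smul (IsSelfAdjoint.all a)).add (hY.smul (IsSelfAdjoint.all b)), ?_⟩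
      have h : a • X + b • Y - ω = a • (X - ω) + b • (Y - ω) := by
        obtain rfl : b = 1 - a := by linarith
        module
      rw [h]
      exact (hX'.smul ha).add (hY'.smul hb))
    (by
      refine Set.disjoint_left.2 fun γ hγ hγ' => ?_
      have h1 : ‖ptB γ‖ < t := mem_ball_zero_iff.1 hγ
      have h2 := ht γ hγ'.1 hγ'.2
      rw [opNorm_eq_norm] at h2
      linarith)
  obtain ⟨S, hS⟩ := exists_re_trace_repr f.toLinearMap
  replace hS : ∀ X, f X = ((S * X).trace).re := hS
  set σ : Matrix (α × β) (α × β) ℂ := (1 / 2 : ℝ) • (S + Sᴴ) with hσ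
  have hσtr : ∀ X, ((σ * X).trace).re = (f X + f Xᴴ) / 2 := by
    intro X
    rw [hS, hS, ← re_trace_conjTranspose_mul, hσ, Matrix.smul_mul, Matrix.trace_smul,
      Complex.smul_re, Matrix.add_mul, Matrix.trace_add, Complex.add_re, smul_eq_mul]
    ring
  have hσherm : σ.IsHermitian := by
    refine Matrix.IsHermitian.smul ?_ (IsSelfAdjoint.all _)
    rw [Matrix.IsHermitian, Matrix.conjTranspose_add, Matrix.conjTranspose_conjTranspose, add_comm]
  have hσf : ∀ X : Matrix (α × β) (α × β) ℂ, X.IsHermitian → ((σ * X).trace).re = f X := by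
    intro X hX
    rw [hσtr, hX.eq]
    ring
  have hωmem : u ≤ f ω := hfC ω ⟨hω, by simpa using Matrix.PosSemidef.zero⟩
  refine ⟨σ, u, .of_dotProduct_mulVec_nonneg hσherm fun x => ?_, fun k hk => ?_, ?_⟩
  · have hx := Matrix.posSemidef_vecMulVec_self_star x
    set P := Matrix.vecMulVec x (star x) with hP
    have hval : star x ⬝ᵥ σ *ᵥ x = (σ * P).trace := by
      rw [hP, Matrix.mul_vecMulVec, Matrix.trace_vecMulVec, dotProduct_comm]
    refine Complex.nonneg_iff.2 ⟨?_, (hσherm.im_star_dotProduct_mulVec_self x).symm⟩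
    rw [hval, hσf P hx.1]
    by_contra! hneg
    set s : ℝ := (f ω - u + 1) / (-f P) with hs
    have hs0 : 0 ≤ s := div_nonneg (by linarith) (by linarith)
    have h := hfC (ω + s • P) ⟨hω.add (hx.1.smul (IsSelfAdjoint.all s)), by
      simpa using hx.smul hs0⟩
    rw [map_add, map_smul, smul_eq_mul] at h
    have hsP : s * f P = -(f ω - u + 1) := by
      rw [hs]
      field_simp [hneg.ne]
    linarith
  · have h1 := hfK k (mem_ball_zero_iff.2 hk)
    have h2 := hfK kᴴ (mem_ball_zero_iff.2 (by
      change ‖(ptB k)ᴴ‖ < t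
      rwa [Matrix.l2_opNorm_conjTranspose]))
    rw [hσtr]
    linarith
  · rwa [hσf ω hω]

/-- A lower bound on all dual values is dominated by the value of a point of the Rains set. -/
lemma exists_memRains_le_re_trace {ω : Matrix (α × β) (α × β) ℂ} (hω : ω.IsHermitian) {t : ℝ}
    (ht0 : 0 < t)
    (ht : ∀ γ : Matrix (α × β) (α × β) ℂ, γ.IsHermitian → (γ - ω).PosSemidef →
      t ≤ opNorm (ptB γ)) :
    ∃ σ : Matrix (α × β) (α × β) ℂ, memRains σ ∧ t ≤ ((ω * σ).trace).re := by
  obtain ⟨σ, u, hσ, hK, hu⟩ := exists_posSemidef_separating hω ht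
  rw [Matrix.trace_mul_comm] at hu
  obtain ⟨B, hB, hBtr⟩ := exists_trace_mul_eq_traceNorm (ptB σ)
  set N := traceNorm (ptB σ) with hN
  have hu0 : 0 < u := by
    have h := hK 0 (by simpa [show ptB (0 : Matrix (α × β) (α × β) ℂ) = 0 from rfl] using ht0)
    simpa using h
  have hNpos : 0 < N := by
    refine (traceNorm_nonneg _).lt_of_ne fun h0 => ?_
    have h := re_trace_mul_le_opNorm_mul_traceNorm (ω := ω) (γ := ω)
      (by simpa using Matrix.PosSemidef.zero) hσ
    rw [← hN, hN, ← h0, mul_zero] at h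
    linarith
  have hr : ∀ r ∈ Set.Ico 0 t, r * N < u := by
    rintro r ⟨hr0, hrt⟩
    have h := hK (ptB (r • B)) (by
      rw [ptB_ptB, norm_smul, Real.norm_of_nonneg hr0]
      nlinarith)
    rw [← trace_ptB_mul_ptB, ptB_ptB, Matrix.mul_smul, Matrix.trace_smul, Matrix.trace_mul_comm,
      hBtr, Complex.smul_re, Complex.ofReal_re, smul_eq_mul] at h
    exact h
  have htN : t ≤ u / N := by
    refine le_of_forall_lt_imp_le_of_dense fun r hrt => ?_
    rcases le_or_gt 0 r with h | h
    · exact (le_div_iff₀ hNpos).2 (hr r ⟨h, hrt⟩).le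
    · exact h.le.trans (div_nonneg hu0.le hNpos.le)
  refine ⟨((N⁻¹ : ℝ) : ℂ) • σ, ⟨hσ.smul (by exact_mod_cast (inv_pos.2 hNpos).le), ?_⟩, ?_⟩
  · refine (traceNorm_smul_le (inv_pos.2 hNpos).le (ptB σ)).trans ?_
    exact (inv_mul_cancel₀ hNpos.ne').le
  · rw [Matrix.mul_smul, Matrix.trace_smul, smul_eq_mul, Complex.re_ofReal_mul]
    refine htN.trans ?_
    rw [div_eq_inv_mul]
    exact mul_le_mul_of_nonneg_left hu (inv_pos.2 hNpos).le

end Duality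

/-- SDP duality for the support function of the Rains set:
`sup{tr[ωσ] : σ ⪰ 0, ‖σ^{T_B}‖₁ ≤ 1} = inf{‖γ^{T_B}‖_∞ : γ Hermitian, γ ≥ ω}`. -/
theorem rains_suppFn_duality {dA dB : ℕ}
    (ω : Matrix (Fin dA × Fin dB) (Fin dA × Fin dB) ℂ) (hω : ω.PosSemidef) :
    sSup {r : ℝ | ∃ σ : Matrix (Fin dA × Fin dB) (Fin dA × Fin dB) ℂ,
        σ.PosSemidef ∧ traceNorm (ptB σ) ≤ 1 ∧ r = ((ω * σ).trace).re} =
      sInf {r : ℝ | ∃ γ : Matrix (Fin dA × Fin dB) (Fin dA × Fin dB) ℂ,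
        γ.IsHermitian ∧ (γ - ω).PosSemidef ∧ r = opNorm (ptB γ)} := by
  set P := {r : ℝ | ∃ σ : Matrix (Fin dA × Fin dB) (Fin dA × Fin dB) ℂ,
    σ.PosSemidef ∧ traceNorm (ptB σ) ≤ 1 ∧ r = ((ω * σ).trace).re} with hP
  set D := {r : ℝ | ∃ γ : Matrix (Fin dA × Fin dB) (Fin dA × Fin dB) ℂ,
    γ.IsHermitian ∧ (γ - ω).PosSemidef ∧ r = opNorm (ptB γ)} with hD
  have hnn : ∀ X : Matrix (Fin dA × Fin dB) (Fin dA × Fin dB) ℂ, 0 ≤ opNorm X := fun X =>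
    Real.iSup_nonneg fun _ => Real.sqrt_nonneg _
  have hweak : ∀ p ∈ P, ∀ d ∈ D, p ≤ d := by
    rintro _ ⟨σ, hσ, hσ1, rfl⟩ _ ⟨γ, -, hγ, rfl⟩
    refine (re_trace_mul_le_opNorm_mul_traceNorm hγ hσ).trans ?_
    exact mul_le_of_le_one_right (hnn _) hσ1
  have hDne : D.Nonempty := ⟨_, ω, hω.1, by simpa using Matrix.PosSemidef.zero, rfl⟩
  have hPzero : (0 : ℝ) ∈ P := by
    refine ⟨0, Matrix.PosSemidef.zero, ?_, by simp⟩
    have h := traceNorm_smul_le le_rfl (0 : Matrix (Fin dA × Fin dB) (Fin dA × Fin dB) ℂ)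
    rw [smul_zero, zero_mul] at h
    exact h.trans zero_le_one
  have hPbdd : BddAbove P := hDne.elim fun d hd => ⟨d, fun p hp => hweak p hp d hd⟩
  have hDbdd : BddBelow D := ⟨0, fun d hd => hweak 0 hPzero d hd⟩
  apply le_antisymm
  · exact csSup_le ⟨0, hPzero⟩ fun p hp => le_csInf hDne fun d hd => hweak p hp d hd
  · rcases le_or_gt (sInf D) 0 with h0 | h0
    · exact h0.trans (le_csSup hPbdd hPzero)
    · obtain ⟨σ, hσ, hle⟩ := exists_memRains_le_re_trace hω.1 h0 fun γ hγ hγω =>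
        csInf_le hDbdd ⟨γ, hγ, hγω, rfl⟩
      exact hle.trans (le_csSup hPbdd ⟨σ, hσ.1, hσ.2, rfl⟩)

end QIT
end
end
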